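/- arXiv:1407.1100 — 9 statements merged into one kernel-verified Lean document; each statement's English description precedes it below -/
import Mathlib

section
/- Let f ∈ PC_q(B). Then: (a) if the set {b ∈ B : f(b) = q_L(b)} is nonempty then it is L-positive; (b) if a, b ∈ B and f(a) = q_L(a), then q_L(a) ≥ ⟨b, La⟩ − f(b); (c) {b ∈ B : f(b) = q_L(b)} ⊆ {b ∈ B : f⊛(b) = q_L(b)}. -/
noncomputable section

variable {B : Type*} [NormedAddCommGroup B] [NormedSpace ℝ B]

/-- The quadratic form `q_L b = (1/2)⟨b, Lb⟩` of a Banach SN space. -/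
def qL (L : B →L[ℝ] (B →L[ℝ] ℝ)) (b : B) : ℝ := (1 / 2) * L b b

/-- `L` is an SN map: `‖L‖ ≤ 1` and `⟨b, Lc⟩ = ⟨c, Lb⟩`. -/
def IsSN (L : B →L[ℝ] (B →L[ℝ] ℝ)) : Prop := ‖L‖ ≤ 1 ∧ ∀ b c : B, L c b = L b c

/-- `f` is a proper convex function `B → (-∞, ∞]` with `f ≥ q_L` on `B`. -/
def PCq (L : B →L[ℝ] (B →L[ℝ] ℝ)) (f : B → EReal) : Prop :=
  (∃ b, f b ≠ ⊤) ∧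
  (∀ x y : B, ∀ t : ℝ, 0 ≤ t → t ≤ 1 →
    f (t • x + (1 - t) • y) ≤ (t : EReal) * f x + ((1 - t : ℝ) : EReal) * f y) ∧
  ∀ b, (qL L b : EReal) ≤ f b

/-- The Fenchel conjugate `f*(b*) = sup_b [⟨b, b*⟩ - f b]`. -/
def fconj (f : B → EReal) (p : B →L[ℝ] ℝ) : EReal := ⨆ b : B, ((p b : ℝ) : EReal) - f b

/-- `f⊛(b) := f*(Lb)`. -/
def fconjL (L : B →L[ℝ] (B →L[ℝ] ℝ)) (f : B → EReal) (b : B) : EReal := fconj f (L b)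

/-- `A` is an `L`-positive subset of `B`. -/
def LPositive (L : B →L[ℝ] (B →L[ℝ] ℝ)) (A : Set B) : Prop :=
  A.Nonempty ∧ ∀ a ∈ A, ∀ c ∈ A, 0 ≤ qL L (a - c)

theorem qL_convexCombination {L : B →L[ℝ] (B →L[ℝ] ℝ)} (hL : IsSN L) (a b : B) (t : ℝ) :
    qL L (t • b + (1 - t) • a) =
      t ^ 2 * qL L b + t * (1 - t) * L a b + (1 - t) ^ 2 * qL L a := by
  simp only [qL, map_add, map_smul, add_apply,
    smul_apply, smul_eq_mul, hL.2 a b]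
  ring

theorem qL_sub {L : B →L[ℝ] (B →L[ℝ] ℝ)} (hL : IsSN L) (a c : B) :
    qL L (a - c) = qL L a + qL L c - L a c := by
  simp only [qL, map_sub, sub_apply, hL.2 a c]
  ring

theorem nonpos_of_forall_le_mul {d k : ℝ} (h : ∀ t : ℝ, 0 < t → t ≤ 1 → d ≤ t * k) :
    d ≤ 0 := by
  by_contra! hd
  have hdk : d ≤ k := by simpa using h 1 one_pos le_rfl
  have hk : 0 < k := hd.trans_le hdk
  have key := h (d / (2 * k)) (by positivity) ((div_le_one (by positivity)).2 (by linarith))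
  have : d / (2 * k) * k = d / 2 := by field_simp
  linarith

/-- At a point where `f` touches `q_L`, the Fenchel-Young gap against `q_L` is nonnegative. -/
theorem PCq.sub_le_qL {L : B →L[ℝ] (B →L[ℝ] ℝ)} (hL : IsSN L) {f : B → EReal}
    (hf : PCq L f) {a : B} (ha : f a = (qL L a : EReal)) (b : B) :
    ((L a b : ℝ) : EReal) - f b ≤ (qL L a : EReal) := by
  obtain ⟨-, hconv, hge⟩ := hf
  have hb := hge b
  have hab := hconv b a
  rw [ha] at hab
  induction hfb : f b with
  | bot => simp [hfb] at hb
  | top => simp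
  | coe r =>
    rw [hfb] at hab
    norm_cast
    have := nonpos_of_forall_le_mul (d := L a b - qL L a - r)
      (k := L a b - qL L a - qL L b) fun t ht ht1 => by
        have h := (hge _).trans (hab t ht.le ht1)
        rw [qL_convexCombination hL] at h
        norm_cast at h
        refine le_of_mul_le_mul_left ?_ ht
        linarith
    linarith

theorem statement1 [CompleteSpace B] [Nontrivial B]
    (L : B →L[ℝ] (B →L[ℝ] ℝ)) (hL : IsSN L)
    (f : B → EReal) (hf : PCq L f) :
    (({b : B | f b = (qL L b : EReal)}).Nonempty →
        LPositive L {b : B | f b = (qL L b : EReal)}) ∧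
    (∀ a b : B, f a = (qL L a : EReal) →
        ((L a b : ℝ) : EReal) - f b ≤ (qL L a : EReal)) ∧
    {b : B | f b = (qL L b : EReal)} ⊆ {b : B | fconjL L f b = (qL L b : EReal)} := by
  refine ⟨fun hne => ⟨hne, fun a ha c hc => ?_⟩, fun a b ha => hf.sub_le_qL hL ha b,
    fun a ha => le_antisymm (iSup_le fun b => hf.sub_le_qL hL ha b) ?_⟩
  · have h := hf.sub_le_qL hL ha c
    rw [show f c = (qL L c : EReal) from hc] at h
    norm_cast at h
    rw [qL_sub hL]
    linarith
  · refine le_iSup_of_le a ?_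
    rw [show f a = (qL L a : EReal) from ha]
    norm_cast
    simp only [qL]
    linarith
end
end

section
/- Let k ∈ PCLSC_q(B). Then the following are equivalent: (a) {b ∈ B : k(b) = q_L(b)} is an r_L-dense L-positive subset of B; (b) k is touching; (c) {b ∈ B : k(b) = q_L(b)} is a stably r_L-dense L-positive subset of B. -/
noncomputable section

variable {B : Type*} [NormedAddCommGroup B] [NormedSpace ℝ B]

/-- `r_L = (1/2)‖·‖² + q_L`. -/
def rL (L : B →L[ℝ] (B →L[ℝ] ℝ)) (b : B) : ℝ := (1 / 2) * ‖b‖ ^ 2 + qL L b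

/-- `A` is maximally `L`-positive. -/
def MaxLPositive (L : B →L[ℝ] (B →L[ℝ] ℝ)) (A : Set B) : Prop :=
  LPositive L A ∧ ∀ A' : Set B, LPositive L A' → A ⊆ A' → A' = A

/-- `A` is `r_L`-dense in `B`: for all `c`, `inf_{a ∈ A} r_L(a - c) ≤ 0`. -/
def RDense (L : B →L[ℝ] (B →L[ℝ] ℝ)) (A : Set B) : Prop :=
  ∀ c : B, (⨅ a ∈ A, ((rL L (a - c) : ℝ) : EReal)) ≤ 0

/-- `A` is stably `r_L`-dense in `B`. -/
def StablyRDense (L : B →L[ℝ] (B →L[ℝ] ℝ)) (A : Set B) : Prop :=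
  ∀ c : B, ∃ K : ℝ, 0 ≤ K ∧
    (⨅ a ∈ {a ∈ A | ‖a - c‖ ≤ K}, ((rL L (a - c) : ℝ) : EReal)) ≤ 0

/-- `f` is touching. -/
def Touching (L : B →L[ℝ] (B →L[ℝ] ℝ)) (f : B → EReal) : Prop :=
  PCq L f ∧
    ∀ c : B, (⨅ d : B, ((f d - (qL L d : EReal)) + ((rL L (d - c) : ℝ) : EReal))) ≤ 0

/-- The function `s_L` on `B*`. -/
def sL (L : B →L[ℝ] (B →L[ℝ] ℝ)) (p : B →L[ℝ] ℝ) : EReal :=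
  ⨆ c : B, ((p c - qL L c - (1 / 2) * ‖L c - p‖ ^ 2 : ℝ) : EReal)

/-- The Fitzpatrick-type function `Φ_A`. -/
def PhiA (L : B →L[ℝ] (B →L[ℝ] ℝ)) (A : Set B) (b : B) : EReal :=
  ⨆ a ∈ A, ((L b a - qL L a : ℝ) : EReal)

/-- `Θ_A` on `B*`. -/
def ThetaA (L : B →L[ℝ] (B →L[ℝ] ℝ)) (A : Set B) (p : B →L[ℝ] ℝ) : EReal :=
  ⨆ a ∈ A, ((p a - qL L a : ℝ) : EReal)

open Filter Topology

lemma qL_add {L : B →L[ℝ] (B →L[ℝ] ℝ)} (hL : IsSN L) (x y : B) :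
    qL L (x + y) = qL L x + L x y + qL L y := by
  have h := hL.2 x y
  simp only [qL, map_add, add_apply]
  linarith

lemma qL_midpoint {L : B →L[ℝ] (B →L[ℝ] ℝ)} (hL : IsSN L) (x y : B) :
    qL L ((1 / 2 : ℝ) • x + (1 - 1 / 2 : ℝ) • y) =
      (qL L x + qL L y) / 2 - qL L (x - y) / 4 := by
  have h := hL.2 x y
  simp only [qL, map_add, map_sub, map_smul, add_apply,
    sub_apply, smul_apply, smul_eq_mul]
  linarith

lemma abs_apply_le_of_isSN {L : B →L[ℝ] (B →L[ℝ] ℝ)} (hL : IsSN L) (x y : B) :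
    |L x y| ≤ ‖x‖ * ‖y‖ := by
  have h1 : ‖L x y‖ ≤ ‖L‖ * ‖x‖ * ‖y‖ := L.le_opNorm₂ x y
  have h2 : ‖L‖ * (‖x‖ * ‖y‖) ≤ 1 * (‖x‖ * ‖y‖) :=
    mul_le_mul_of_nonneg_right hL.1 (by positivity)
  rw [Real.norm_eq_abs] at h1
  linarith

lemma abs_qL_le {L : B →L[ℝ] (B →L[ℝ] ℝ)} (hL : IsSN L) (x : B) :
    |qL L x| ≤ (1 / 2) * ‖x‖ ^ 2 := by
  have h := abs_apply_le_of_isSN hL x x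
  rw [qL, abs_mul, abs_of_pos (by norm_num : (0 : ℝ) < 1 / 2)]
  linarith

lemma rL_nonneg {L : B →L[ℝ] (B →L[ℝ] ℝ)} (hL : IsSN L) (x : B) : 0 ≤ rL L x := by
  have h := (abs_le.1 (abs_qL_le hL x)).1
  rw [rL]
  linarith

lemma rL_add_le {L : B →L[ℝ] (B →L[ℝ] ℝ)} (hL : IsSN L) (x y : B) :
    rL L (x + y) ≤ rL L x + 2 * (‖x‖ * ‖y‖) + ‖y‖ ^ 2 := by
  have h1 := (abs_le.1 (abs_apply_le_of_isSN hL x y)).2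
  have h2 := (abs_le.1 (abs_qL_le hL y)).2
  have h3 : ‖x + y‖ ^ 2 ≤ (‖x‖ + ‖y‖) ^ 2 := by gcongr; exact norm_add_le x y
  rw [rL, rL, qL_add hL]
  linarith

lemma continuous_qL (L : B →L[ℝ] (B →L[ℝ] ℝ)) : Continuous (qL L) := by
  unfold qL
  fun_prop

lemma PCq.neg_qL_sub_le {L : B →L[ℝ] (B →L[ℝ] ℝ)} (hL : IsSN L) {f : B → EReal}
    (hf : PCq L f) {x y : B} {α β : ℝ} (hx : f x ≤ ((qL L x + α : ℝ) : EReal))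
    (hy : f y ≤ ((qL L y + β : ℝ) : EReal)) : -qL L (x - y) ≤ 2 * (α + β) := by
  have h1 := (hf.2.2 _).trans (hf.2.1 x y (1 / 2) (by norm_num) (by norm_num))
  have h2 : ((1 / 2 : ℝ) : EReal) * f x + ((1 - 1 / 2 : ℝ) : EReal) * f y ≤
      ((1 / 2 : ℝ) : EReal) * ((qL L x + α : ℝ) : EReal) +
        ((1 - 1 / 2 : ℝ) : EReal) * ((qL L y + β : ℝ) : EReal) :=
    add_le_add (mul_le_mul_of_nonneg_left hx (EReal.coe_nonneg.2 (by norm_num)))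
      (mul_le_mul_of_nonneg_left hy (EReal.coe_nonneg.2 (by norm_num)))
  have h3 := h1.trans h2
  rw [qL_midpoint hL] at h3
  norm_cast at h3
  linarith

lemma PCq.lPositive_of_nonempty {L : B →L[ℝ] (B →L[ℝ] ℝ)} (hL : IsSN L) {f : B → EReal}
    (hf : PCq L f) (hne : {b : B | f b = (qL L b : EReal)}.Nonempty) :
    LPositive L {b : B | f b = (qL L b : EReal)} := by
  refine ⟨hne, fun a ha c hc => ?_⟩
  have h := hf.neg_qL_sub_le hL (x := a) (y := c) (α := 0) (β := 0)
    (by rw [add_zero]; exact le_of_eq ha) (by rw [add_zero]; exact le_of_eq hc)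
  linarith

lemma StablyRDense.rDense {L : B →L[ℝ] (B →L[ℝ] ℝ)} {A : Set B} (h : StablyRDense L A) :
    RDense L A := by
  intro c
  obtain ⟨K, -, hK⟩ := h c
  exact (biInf_mono fun a ha => ha.1).trans hK

lemma RDense.touching {L : B →L[ℝ] (B →L[ℝ] ℝ)} {f : B → EReal} (hf : PCq L f)
    (h : RDense L {b : B | f b = (qL L b : EReal)}) : Touching L f := by
  refine ⟨hf, fun c => le_trans (le_iInf₂ fun a ha => ?_) (h c)⟩
  refine (iInf_le _ a).trans ?_
  rw [show f a = (qL L a : EReal) from ha, ← EReal.coe_sub, sub_self, EReal.coe_zero, zero_add]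

lemma Touching.exists_approx {L : B →L[ℝ] (B →L[ℝ] ℝ)} (hL : IsSN L) {f : B → EReal}
    (hf : Touching L f) (c : B) {ε : ℝ} (hε : 0 < ε) :
    ∃ d, f d ≤ ((qL L d + ε : ℝ) : EReal) ∧ rL L (d - c) ≤ ε := by
  have h : (⨅ d : B, ((f d - (qL L d : EReal)) + ((rL L (d - c) : ℝ) : EReal))) < (ε : EReal) :=
    (hf.2 c).trans_lt (EReal.coe_pos.2 hε)
  obtain ⟨d, hd⟩ := iInf_lt_iff.1 h
  have hq := hf.1.2.2 d
  have hr := rL_nonneg hL (d - c)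
  refine ⟨d, ?_⟩
  generalize f d = v at hd hq ⊢
  induction v with
  | bot => simp at hq
  | top => simp at hd
  | coe v =>
    norm_cast at hd hq ⊢
    exact ⟨by linarith, by linarith⟩

lemma Touching.exists_contact_near [CompleteSpace B] {L : B →L[ℝ] (B →L[ℝ] ℝ)} (hL : IsSN L)
    {f : B → EReal} (hf : Touching L f) (hlsc : LowerSemicontinuous f) (c : B) {δ : ℝ}
    (hδ : 0 < δ) :
    ∃ d a, f d ≤ ((qL L d + δ ^ 2 : ℝ) : EReal) ∧ rL L (d - c) ≤ δ ^ 2 ∧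
      f a = (qL L a : EReal) ∧ ‖a - d‖ ≤ 8 * δ := by
  have step (n : ℕ) (e : B) := hf.exists_approx hL e (ε := (δ / 2 ^ n) ^ 2) (by positivity)
  choose g hgf hgr using step
  let d : ℕ → B := fun n => Nat.rec (g 0 c) (fun n e => g (n + 1) e) n
  have hdf : ∀ n, f (d n) ≤ ((qL L (d n) + (δ / 2 ^ n) ^ 2 : ℝ) : EReal) := by
    rintro (_ | n)
    · exact hgf 0 c
    · exact hgf (n + 1) (d n)
  have hdist : ∀ n, dist (d n) (d (n + 1)) ≤ 8 * δ / 2 / 2 ^ n := by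
    intro n
    have h1 : rL L (d (n + 1) - d n) ≤ (δ / 2 ^ (n + 1)) ^ 2 := hgr (n + 1) (d n)
    have h2 := hf.1.neg_qL_sub_le hL (hdf (n + 1)) (hdf n)
    rw [dist_comm, dist_eq_norm]
    rw [rL] at h1
    have h3 : δ / 2 ^ (n + 1) = δ / 2 ^ n / 2 := by rw [pow_succ, div_div]
    rw [h3] at h1 h2
    rw [show 8 * δ / 2 / 2 ^ n = 4 * (δ / 2 ^ n) by ring]
    have h4 : 0 < δ / 2 ^ n := by positivity
    refine le_of_sq_le_sq ?_ (by positivity)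
    nlinarith
  obtain ⟨a, ha⟩ := cauchySeq_tendsto_of_complete (cauchySeq_of_le_geometric_two hdist)
  refine ⟨d 0, a, by simpa using hdf 0, by simpa [d] using hgr 0 c, ?_, ?_⟩
  · refine le_antisymm ?_ (hf.1.2.2 a)
    refine EReal.le_of_forall_lt_iff_le.1 fun z hz => ?_
    have hε : Tendsto (fun n : ℕ => (δ / 2 ^ n) ^ 2) atTop (𝓝 0) := by
      have h : Tendsto (fun n : ℕ => (δ * (1 / 2) ^ n) ^ 2) atTop (𝓝 ((δ * 0) ^ 2)) :=
        ((tendsto_pow_atTop_nhds_zero_of_lt_one (by norm_num) (by norm_num)).const_mul δ).pow 2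
      simpa [div_eq_mul_inv] using h
    have hlim : Tendsto (fun n => qL L (d n) + (δ / 2 ^ n) ^ 2) atTop (𝓝 (qL L a)) := by
      simpa using (((continuous_qL L).tendsto a).comp ha).add hε
    by_contra! hlt
    obtain ⟨n, hn1, hn2⟩ := ((ha.eventually (hlsc a z hlt)).and
      (hlim.eventually_lt_const (EReal.coe_lt_coe_iff.1 hz))).exists
    exact absurd ((hdf n).trans_lt (EReal.coe_lt_coe_iff.2 hn2)) hn1.not_gt
  · rw [← dist_eq_norm, dist_comm]
    exact dist_le_of_le_geometric_two_of_tendsto₀ hdist ha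

lemma Touching.stablyRDense [CompleteSpace B] {L : B →L[ℝ] (B →L[ℝ] ℝ)} (hL : IsSN L)
    {f : B → EReal} (hf : Touching L f) (hlsc : LowerSemicontinuous f) :
    StablyRDense L {b : B | f b = (qL L b : EReal)} := by
  intro c
  obtain ⟨-, e, -, -, he, -⟩ := hf.exists_contact_near hL hlsc c one_pos
  set M := ‖e - c‖ with hM
  have hM0 : 0 ≤ M := norm_nonneg _
  set K := 4 + 4 * M with hK
  have hK0 : 0 ≤ K := by positivity
  refine ⟨K + 8, by positivity, EReal.le_of_forall_lt_iff_le.1 fun η hη => ?_⟩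
  have hη : 0 < η := EReal.coe_pos.1 hη
  set δ := min 1 (η / (65 + 16 * K)) with hδdef
  have hδ0 : 0 < δ := by positivity
  have hδ1 : δ ≤ 1 := min_le_left _ _
  have hδη : δ * (65 + 16 * K) ≤ η := (le_div_iff₀ (by positivity)).1 (min_le_right _ _)
  have hδsq : δ ^ 2 ≤ δ := by nlinarith
  obtain ⟨d, a, hd, hr, ha, had⟩ := hf.exists_contact_near hL hlsc c hδ0
  have hdc : ‖d - c‖ ≤ K := by
    have h1 := hf.1.neg_qL_sub_le hL hd (y := e) (β := 0) (by rw [add_zero]; exact he.le)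
    have h2 := qL_add hL (d - e) (e - c)
    rw [sub_add_sub_cancel] at h2
    have h3 := (abs_le.1 (abs_apply_le_of_isSN hL (d - e) (e - c))).1
    have h4 := (abs_le.1 (abs_qL_le hL (e - c))).1
    have h5 : ‖d - e‖ ≤ ‖d - c‖ + M := by
      rw [hM, norm_sub_rev e c]; exact norm_sub_le_norm_sub_add_norm_sub d c e
    have h6 : ‖d - e‖ * M ≤ (‖d - c‖ + M) * M := mul_le_mul_of_nonneg_right h5 hM0
    rw [rL] at hr
    rw [← hM] at h3 h4
    by_contra! hlt
    nlinarith [norm_nonneg (d - c)]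
  have hac : a - c = (d - c) + (a - d) := by abel
  have hmem : a ∈ {a ∈ {b : B | f b = (qL L b : EReal)} | ‖a - c‖ ≤ K + 8} := by
    refine ⟨ha, ?_⟩
    rw [hac]
    linarith [norm_add_le (d - c) (a - d)]
  refine (iInf₂_le a hmem).trans (EReal.coe_le_coe_iff.2 ?_)
  rw [hac]
  have h1 := rL_add_le hL (d - c) (a - d)
  have h2 : ‖d - c‖ * ‖a - d‖ ≤ K * (8 * δ) := by gcongr
  have h3 : ‖a - d‖ ^ 2 ≤ (8 * δ) ^ 2 := by gcongr
  nlinarith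

theorem statement2 [CompleteSpace B] [Nontrivial B]
    (L : B →L[ℝ] (B →L[ℝ] ℝ)) (hL : IsSN L)
    (k : B → EReal) (hk : PCq L k) (hlsc : LowerSemicontinuous k) :
    ((RDense L {b : B | k b = (qL L b : EReal)} ∧
        LPositive L {b : B | k b = (qL L b : EReal)}) ↔ Touching L k) ∧
    (Touching L k ↔
      (StablyRDense L {b : B | k b = (qL L b : EReal)} ∧
        LPositive L {b : B | k b = (qL L b : EReal)})) := by
  have hbc (h : Touching L k) : StablyRDense L {b : B | k b = (qL L b : EReal)} ∧
      LPositive L {b : B | k b = (qL L b : EReal)} := by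
    obtain ⟨-, a, -, -, ha, -⟩ := h.exists_contact_near hL hlsc 0 one_pos
    exact ⟨h.stablyRDense hL hlsc, hk.lPositive_of_nonempty hL ⟨a, ha⟩⟩
  exact ⟨⟨fun h => h.1.touching hk, fun h => ⟨(hbc h).1.rDense, (hbc h).2⟩⟩,
    hbc, fun h => h.1.rDense.touching hk⟩
end
end

section
/- Let A be a closed, r_L-dense, L-positive subset of B. Then A is maximally L-positive. -/
noncomputable section

variable {B : Type*} [NormedAddCommGroup B] [NormedSpace ℝ B]

theorem statement3 [CompleteSpace B] [Nontrivial B]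
    (L : B →L[ℝ] (B →L[ℝ] ℝ)) (hL : IsSN L)
    (A : Set B) (hclosed : IsClosed A) (hdense : RDense L A) (hpos : LPositive L A) :
    MaxLPositive L A := by
  refine ⟨hpos, fun A' hA' hsub => Set.Subset.antisymm (fun c hc => ?_) hsub⟩
  rw [← hclosed.closure_eq, Metric.mem_closure_iff]
  intro ε hε
  have hlt : (⨅ a ∈ A, ((rL L (a - c) : ℝ) : EReal)) < ((ε ^ 2 / 2 : ℝ) : EReal) :=
    (hdense c).trans_lt (EReal.coe_pos.mpr (by positivity))
  simp only [iInf_lt_iff, EReal.coe_lt_coe_iff] at hlt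
  obtain ⟨a, ha, hr⟩ := hlt
  refine ⟨a, ha, ?_⟩
  have hq : 0 ≤ qL L (a - c) := hA'.2 a (hsub ha) c hc
  rw [dist_comm, dist_eq_norm]
  unfold rL at hr
  exact lt_of_pow_lt_pow_left₀ 2 hε.le (by linarith)
end
end

section
/- Let h ∈ PC_q(B). Then h is touching if and only if h*(b*) ≥ s_L(b*) for every b* ∈ B*. -/
noncomputable section

variable {B : Type*} [NormedAddCommGroup B] [NormedSpace ℝ B]

/-- An upper bound of `l - 1/2 ‖·‖²` is at least `1/2 ‖l‖²`. -/
theorem half_opNorm_sq_le_of_forall (l : B →L[ℝ] ℝ) {C : ℝ}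
    (hC : ∀ w : B, l w - (1 / 2) * ‖w‖ ^ 2 ≤ C) : (1 / 2) * ‖l‖ ^ 2 ≤ C := by
  have hC0 : 0 ≤ C := by simpa using hC 0
  have hb : ‖l‖ ≤ √(2 * C) := by
    refine l.opNorm_le_bound (Real.sqrt_nonneg _) fun w => ?_
    have hd := discrim_le_zero (a := (1 / 2) * ‖w‖ ^ 2) (b := -l w) (c := C) fun s => by
      have := hC (s • w)
      rw [map_smul, smul_eq_mul, norm_smul, mul_pow, Real.norm_eq_abs, sq_abs] at this
      linarith
    rw [discrim] at hd
    rw [Real.norm_eq_abs]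
    refine abs_le_of_sq_le_sq ?_ (by positivity)
    rw [mul_pow, Real.sq_sqrt (by positivity)]
    linarith
  have := pow_le_pow_left₀ (norm_nonneg l) hb 2
  rw [Real.sq_sqrt (by positivity)] at this
  linarith

/-- The Fenchel–Young inequality for `1/2 ‖·‖²`. -/
theorem neg_half_opNorm_sq_le (l : B →L[ℝ] ℝ) (w : B) :
    -((1 / 2) * ‖l‖ ^ 2) ≤ l w + (1 / 2) * ‖w‖ ^ 2 := by
  have h1 := neg_le_of_abs_le (l.le_opNorm w)
  nlinarith [sq_nonneg (‖l‖ - ‖w‖)]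

theorem rL_sub (L : B →L[ℝ] (B →L[ℝ] ℝ)) (hL : ∀ b c : B, L c b = L b c) (d c : B) :
    rL L (d - c) = (1 / 2) * ‖d - c‖ ^ 2 + qL L d - L c d + qL L c := by
  simp only [rL, qL, map_sub, sub_apply]
  rw [hL c d]
  ring

theorem concaveOn_neg_half_norm_sub_sq_add (l : B →L[ℝ] ℝ) (c : B) (a : ℝ) :
    ConcaveOn ℝ Set.univ fun d => l d + a - (1 / 2) * ‖d - c‖ ^ 2 := by
  have h1 : ConvexOn ℝ Set.univ fun d : B => ‖d - c‖ := by
    simpa [dist_eq_norm] using convexOn_univ_dist c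
  have h2 := (h1.pow (fun _ _ => norm_nonneg _) 2).smul (c := (1 / 2 : ℝ)) (by norm_num)
  exact ((l.toLinearMap.concaveOn convex_univ).add_const a).sub h2

/-- A convex function lying above a continuous concave one is separated from it by an
affine function. -/
theorem exists_affine_between {f : B → EReal} {k : B → ℝ} (hf : ∃ b, f b ≠ ⊤)
    (hconv : ∀ x y : B, ∀ t : ℝ, 0 ≤ t → t ≤ 1 →
      f (t • x + (1 - t) • y) ≤ (t : EReal) * f x + ((1 - t : ℝ) : EReal) * f y)
    (hk : ConcaveOn ℝ Set.univ k) (hkc : Continuous k) (hkf : ∀ b, (k b : EReal) ≤ f b) :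
    ∃ (p : B →L[ℝ] ℝ) (β : ℝ), (∀ b, k b ≤ p b + β) ∧
      ∀ b, ((p b + β : ℝ) : EReal) ≤ f b := by
  have hS : Convex ℝ {z : B × ℝ | z.2 < k z.1} := by
    simpa using hk.convex_strict_hypograph
  have hSo : IsOpen {z : B × ℝ | z.2 < k z.1} :=
    isOpen_lt continuous_snd (hkc.comp continuous_fst)
  have hE : Convex ℝ {z : B × ℝ | f z.1 ≤ z.2} := by
    intro x hx y hy a b ha hb hab
    obtain rfl : b = 1 - a := by linarith
    simp only [Set.mem_ofPred_eq, Prod.fst_add, Prod.smul_fst, Prod.snd_add, Prod.smul_snd,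
      smul_eq_mul] at hx hy ⊢
    refine (hconv _ _ a ha (by linarith)).trans ?_
    push_cast
    refine add_le_add (mul_le_mul_of_nonneg_left hx (by exact_mod_cast ha)) ?_
    exact mul_le_mul_of_nonneg_left hy (by exact_mod_cast hb)
  have hdisj : Disjoint {z : B × ℝ | z.2 < k z.1} {z : B × ℝ | f z.1 ≤ z.2} := by
    rw [Set.disjoint_left]
    intro z hz hz'
    exact absurd (EReal.coe_le_coe_iff.1 ((hkf z.1).trans hz')) (not_le.2 hz)
  obtain ⟨F, u, hFS, hFE⟩ := geometric_hahn_banach_open hS hSo hE hdisj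
  have hF : ∀ d t, F (d, t) = F (d, 0) + F (0, 1) * t := fun d t => by
    rw [mul_comm, ← smul_eq_mul, ← map_smul, ← map_add]
    simp
  have hpos : 0 < F (0, 1) := by
    obtain ⟨b, hb⟩ := hf
    have hb' : f b ≠ ⊥ := ne_bot_of_le_ne_bot (EReal.coe_ne_bot _) (hkf b)
    have h1 := hFE (b, (f b).toReal) (EReal.le_coe_toReal hb)
    have hkb : k b ≤ (f b).toReal := by
      rw [← EReal.coe_le_coe_iff, EReal.coe_toReal hb hb']
      exact hkf b
    have h2 := hFS (b, k b - 1) (by simp)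
    rw [hF] at h1 h2
    nlinarith
  refine ⟨-((F (0, 1))⁻¹ • F.comp (ContinuousLinearMap.inl ℝ B ℝ)), (F (0, 1))⁻¹ * u, ?_, ?_⟩
  · intro b
    refine le_of_forall_lt fun t ht => ?_
    have h1 := hFS (b, t) ht
    rw [hF] at h1
    simp only [neg_apply, smul_apply, smul_eq_mul,
      ContinuousLinearMap.comp_apply, ContinuousLinearMap.inl_apply]
    have : t < (u - F (b, 0)) / F (0, 1) := by rw [lt_div_iff₀ hpos]; linarith
    rw [div_eq_inv_mul] at this
    linarith
  · intro b
    refine EReal.le_of_forall_lt_iff_le.1 fun t ht => ?_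
    have h1 := hFE (b, t) ht.le
    rw [hF] at h1
    simp only [neg_apply, smul_apply, smul_eq_mul,
      ContinuousLinearMap.comp_apply, ContinuousLinearMap.inl_apply]
    have : (u - F (b, 0)) / F (0, 1) ≤ t := by rw [div_le_iff₀ hpos]; linarith
    rw [div_eq_inv_mul] at this
    exact_mod_cast (by linarith : -((F (0, 1))⁻¹ * F (b, 0)) + (F (0, 1))⁻¹ * u ≤ t)

theorem statement5 [CompleteSpace B] [Nontrivial B]
    (L : B →L[ℝ] (B →L[ℝ] ℝ)) (hL : IsSN L)
    (h : B → EReal) (hh : PCq L h) :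
    Touching L h ↔ ∀ p : B →L[ℝ] ℝ, sL L p ≤ fconj h p := by
  have hbot : ∀ b, h b ≠ ⊥ := fun b => ne_bot_of_le_ne_bot (EReal.coe_ne_bot _) (hh.2.2 b)
  constructor
  · rintro ⟨-, ht⟩ p
    refine iSup_le fun c => ?_
    refine EReal.ge_of_forall_gt_iff_ge.1 fun x hx => ?_
    have hx := EReal.coe_lt_coe_iff.1 hx
    set s := p c - qL L c - (1 / 2) * ‖L c - p‖ ^ 2 with hs
    obtain ⟨d, hd⟩ := iInf_lt_iff.1 ((ht c).trans_lt (EReal.coe_pos.2 (sub_pos.2 hx)))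
    refine le_trans ?_ (le_iSup _ d)
    have hyoung := neg_half_opNorm_sq_le (p - L c) (d - c)
    rw [norm_sub_rev] at hyoung
    rw [rL_sub L hL.2] at hd
    induction hv : h d with
    | bot => exact absurd hv (hbot d)
    | top =>
      rw [hv, EReal.top_sub_coe, EReal.top_add_coe] at hd
      exact absurd hd (by simp)
    | coe v =>
      rw [hv] at hd
      norm_cast at hd ⊢
      simp only [map_sub, sub_apply] at hyoung
      have hq : L c c = 2 * qL L c := by rw [qL]; ring
      linarith
  · intro H
    refine ⟨hh, fun c => ?_⟩
    by_contra! hlt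
    obtain ⟨m, hm0, hm⟩ := EReal.lt_iff_exists_real_btwn.1 hlt
    have hm0 : 0 < m := EReal.coe_pos.1 hm0
    obtain ⟨p, β, hkp, hpf⟩ := exists_affine_between
      (k := fun d => L c d + (m - qL L c) - (1 / 2) * ‖d - c‖ ^ 2) hh.1 hh.2.1
      (concaveOn_neg_half_norm_sub_sq_add _ _ _) (by fun_prop) fun d => by
        have hd := hm.le.trans (iInf_le _ d)
        rw [rL_sub L hL.2] at hd
        induction hv : h d with
        | bot => exact absurd hv (hbot d)
        | top => exact le_top
        | coe v =>
          rw [hv] at hd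
          norm_cast at hd ⊢
          linarith
    have hconj : fconj h p ≤ ((-β : ℝ) : EReal) := iSup_le fun d => by
      have hd := hpf d
      induction hv : h d with
      | bot => exact absurd hv (hbot d)
      | top => simp
      | coe v =>
        rw [hv] at hd
        norm_cast at hd ⊢
        linarith
    have hs := ((le_iSup _ c).trans (H p)).trans hconj
    have hs := EReal.coe_le_coe_iff.1 hs
    have hn : (1 / 2) * ‖L c - p‖ ^ 2 ≤ β - m + p c - qL L c :=
      half_opNorm_sq_le_of_forall _ fun w => by
        have hw := hkp (w + c)
        have hq : L c c = 2 * qL L c := by rw [qL]; ring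
        simp only [map_add, add_sub_cancel_right] at hw
        rw [sub_apply]
        linarith
    linarith
end
end

section
/- For every x* ∈ E* and x** ∈ E**, the infimum over all (y, y*) ∈ E × E* of the quantity (1/2)‖y* − x*‖² + (1/2)‖ŷ − x**‖² + ⟨y* − x*, ŷ − x**⟩ equals 0, where ŷ denotes the canonical image of y in E** and ⟨u*, u**⟩ := u**(u*) for u* ∈ E*, u** ∈ E**. (That is, the image of E × E* under (y, y*) ↦ (y*, ŷ) is r-dense in E* × E** in the sense of quasidensity.) -/
noncomputable section

open NormedSpace

/-- The quantity `½‖z‖² + ½‖φ‖² + φ z` is nonnegative. -/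
theorem half_sq_add_half_sq_add_apply_nonneg {F : Type*} [NormedAddCommGroup F] [NormedSpace ℝ F]
    (φ : F →L[ℝ] ℝ) (z : F) :
    0 ≤ (1 / 2) * ‖z‖ ^ 2 + (1 / 2) * ‖φ‖ ^ 2 + φ z := by
  have h := φ.le_opNorm z
  rw [Real.norm_eq_abs] at h
  nlinarith [neg_abs_le (φ z), sq_nonneg (‖z‖ - ‖φ‖)]

/-- The quantity `½‖z‖² + ½‖φ‖² + φ z` can be made arbitrarily small by a choice of `z`. -/
theorem exists_half_sq_add_half_sq_add_apply_lt {F : Type*} [NormedAddCommGroup F]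
    [NormedSpace ℝ F] (φ : F →L[ℝ] ℝ) {ε : ℝ} (hε : 0 < ε) :
    ∃ z : F, (1 / 2) * ‖z‖ ^ 2 + (1 / 2) * ‖φ‖ ^ 2 + φ z < ε := by
  have hφ := norm_nonneg φ
  have hδ : 0 < ε / (‖φ‖ + 1) := by positivity
  have hδε : ε / (‖φ‖ + 1) * (‖φ‖ + 1) = ε := by field_simp
  obtain ⟨u, hu, hru⟩ : ∃ u : F, ‖u‖ < 1 ∧ ‖φ‖ - ε / (‖φ‖ + 1) < -φ u := by
    obtain ⟨u, hu, hru⟩ := φ.exists_lt_apply_of_lt_opNorm (sub_lt_self ‖φ‖ hδ)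
    rcases abs_choice (φ u) with h | h
    · exact ⟨-u, by simpa using hu, by simpa [Real.norm_eq_abs, h] using hru⟩
    · exact ⟨u, hu, by simpa [Real.norm_eq_abs, h] using hru⟩
  refine ⟨‖φ‖ • u, ?_⟩
  have hz : ‖‖φ‖ • u‖ ≤ ‖φ‖ := by
    rw [norm_smul, norm_norm]
    exact mul_le_of_le_one_right hφ hu.le
  have hz2 : ‖‖φ‖ • u‖ ^ 2 ≤ ‖φ‖ ^ 2 := by gcongr
  rw [map_smul, smul_eq_mul]
  nlinarith [mul_le_mul_of_nonneg_left hru.le hφ]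

theorem statement8 {E : Type*} [NormedAddCommGroup E] [NormedSpace ℝ E]
    [CompleteSpace E] [Nontrivial E]
    (x' : E →L[ℝ] ℝ) (x'' : (E →L[ℝ] ℝ) →L[ℝ] ℝ) :
    (⨅ p : E × (E →L[ℝ] ℝ),
        ((1 / 2) * ‖p.2 - x'‖ ^ 2 +
          (1 / 2) * ‖inclusionInDoubleDual ℝ E p.1 - x''‖ ^ 2 +
          (inclusionInDoubleDual ℝ E p.1 - x'') (p.2 - x'))) = 0 := by
  refine ciInf_eq_of_forall_ge_of_forall_gt_exists_lt
    (fun p => half_sq_add_half_sq_add_apply_nonneg _ _) fun ε hε => ?_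
  obtain ⟨z, hz⟩ :=
    exists_half_sq_add_half_sq_add_apply_lt (inclusionInDoubleDual ℝ E 0 - x'') hε
  exact ⟨(0, z + x'), by simpa only [add_sub_cancel_right] using hz⟩
end
end

section
/- Let A ⊆ E × E* be closed, monotone and quasidense. Then A is maximally monotone. -/
noncomputable section

open Filter Topology

variable {E : Type*} [NormedAddCommGroup E] [NormedSpace ℝ E]

/-- `A ⊆ E × E*` is a monotone set. -/
def MonotoneSet (A : Set (E × (E →L[ℝ] ℝ))) : Prop :=
  A.Nonempty ∧ ∀ p ∈ A, ∀ q ∈ A, 0 ≤ (p.2 - q.2) (p.1 - q.1)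

/-- `A ⊆ E × E*` is maximally monotone. -/
def MaxMonotone (A : Set (E × (E →L[ℝ] ℝ))) : Prop :=
  MonotoneSet A ∧ ∀ A' : Set (E × (E →L[ℝ] ℝ)), MonotoneSet A' → A ⊆ A' → A' = A

/-- `r_L((s,s*) - (x,x*)) = (1/2)‖s - x‖² + (1/2)‖s* - x*‖² + ⟨s - x, s* - x*⟩`. -/
def rQ (q p : E × (E →L[ℝ] ℝ)) : ℝ :=
  (1 / 2) * ‖q.1 - p.1‖ ^ 2 + (1 / 2) * ‖q.2 - p.2‖ ^ 2 + (q.2 - p.2) (q.1 - p.1)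

/-- `A ⊆ E × E*` is quasidense. -/
def Quasidense (A : Set (E × (E →L[ℝ] ℝ))) : Prop :=
  ∀ p : E × (E →L[ℝ] ℝ), (⨅ q ∈ A, ((rQ q p : ℝ) : EReal)) ≤ 0

/-- `A ⊆ E × E*` is stably quasidense (with the norm
`‖(x, x*)‖ = (‖x‖² + ‖x*‖²)^{1/2}` on `E × E*`). -/
def StablyQuasidense (A : Set (E × (E →L[ℝ] ℝ))) : Prop :=
  ∀ p : E × (E →L[ℝ] ℝ), ∃ K : ℝ, 0 ≤ K ∧
    (⨅ q ∈ {q ∈ A | Real.sqrt (‖q.1 - p.1‖ ^ 2 + ‖q.2 - p.2‖ ^ 2) ≤ K},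
      ((rQ q p : ℝ) : EReal)) ≤ 0

/-- A point monotonically related to a quasidense set lies in the closure of that set. -/
theorem Quasidense.mem_closure {A : Set (E × (E →L[ℝ] ℝ))} (hqd : Quasidense A)
    {p : E × (E →L[ℝ] ℝ)} (hp : ∀ q ∈ A, 0 ≤ (q.2 - p.2) (q.1 - p.1)) : p ∈ closure A := by
  rw [Metric.mem_closure_iff]
  intro ε hε
  have hlt : (⨅ q ∈ A, ((rQ q p : ℝ) : EReal)) < ((ε ^ 2 / 2 : ℝ) : EReal) :=
    (hqd p).trans_lt (EReal.coe_pos.2 (by positivity))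
  obtain ⟨q, hq⟩ := iInf_lt_iff.1 hlt
  obtain ⟨hqA, hq⟩ := iInf_lt_iff.1 hq
  rw [EReal.coe_lt_coe_iff, rQ] at hq
  have hpos := hp q hqA
  refine ⟨q, hqA, ?_⟩
  rw [dist_comm, Prod.dist_eq, max_lt_iff, dist_eq_norm, dist_eq_norm]
  constructor
  · refine lt_of_pow_lt_pow_left₀ 2 hε.le ?_
    linarith [sq_nonneg ‖q.2 - p.2‖]
  · refine lt_of_pow_lt_pow_left₀ 2 hε.le ?_
    linarith [sq_nonneg ‖q.1 - p.1‖]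

theorem statement9 [CompleteSpace E] [Nontrivial E]
    (A : Set (E × (E →L[ℝ] ℝ))) (hclosed : IsClosed A)
    (hmono : MonotoneSet A) (hqd : Quasidense A) :
    MaxMonotone A := by
  refine ⟨hmono, fun A' hA' hsub => Set.Subset.antisymm (fun p hp => ?_) hsub⟩
  rw [← hclosed.closure_eq]
  exact hqd.mem_closure fun q hq => hA'.2 q (hsub hq) p hp
end
end

section
/- Suppose E is reflexive and A ⊆ E × E* is maximally monotone. Then A is closed and stably quasidense. -/
noncomputable section

open Filter Topology

variable {E : Type*} [NormedAddCommGroup E] [NormedSpace ℝ E]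

lemma half_sq_norm_le_of_forall_apply_le {X : Type*} [NormedAddCommGroup X] [NormedSpace ℝ X]
    (f : X →L[ℝ] ℝ) (k : ℝ) (h : ∀ x, f x - (1 / 2) * ‖x‖ ^ 2 ≤ k) :
    (1 / 2) * ‖f‖ ^ 2 ≤ k := by
  have hk : 0 ≤ k := by simpa using h 0
  have hf : ‖f‖ ≤ √(2 * k) := by
    refine f.opNorm_le_bound (Real.sqrt_nonneg _) fun x => ?_
    have hdisc : discrim ((1 / 2) * ‖x‖ ^ 2) (-f x) k ≤ 0 := by
      refine discrim_le_zero fun t => ?_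
      have ht := h (t • x)
      rw [map_smul, norm_smul, smul_eq_mul, mul_pow, Real.norm_eq_abs, sq_abs] at ht
      linarith
    rw [discrim] at hdisc
    rw [Real.norm_eq_abs]
    refine abs_le_of_sq_le_sq ?_ (by positivity)
    rw [mul_pow, Real.sq_sqrt (by positivity)]
    linarith
  have hsq := pow_le_pow_left₀ (norm_nonneg f) hf 2
  rw [Real.sq_sqrt (by positivity)] at hsq
  linarith

lemma neg_half_sq_norm_le_apply (x : E) (f : E →L[ℝ] ℝ) :
    -((1 / 2) * ‖x‖ ^ 2 + (1 / 2) * ‖f‖ ^ 2) ≤ f x := by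
  have h₁ := neg_le_of_abs_le (f.le_opNorm x)
  nlinarith [sq_nonneg (‖f‖ - ‖x‖)]

/-- On the convex hull of the graph of the duality pairing over a monotone set, the last
coordinate dominates the duality pairing. -/
lemma MonotoneSet.apply_le_of_mem_convexHull {B : Set (E × (E →L[ℝ] ℝ))} (hB : MonotoneSet B)
    {w : (E × (E →L[ℝ] ℝ)) × ℝ} (hw : w ∈ convexHull ℝ ((fun b => (b, b.2 b.1)) '' B)) :
    w.1.2 w.1.1 ≤ w.2 := by
  set T : Set ((E × (E →L[ℝ] ℝ)) × ℝ) := (fun b => (b, b.2 b.1)) '' B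
  have hconv : ∀ v : (E × (E →L[ℝ] ℝ)) × ℝ,
      Convex ℝ {u : (E × (E →L[ℝ] ℝ)) × ℝ | v.1.2 u.1.1 + u.1.2 v.1.1 ≤ v.2 + u.2} := by
    intro v u₁ h₁ u₂ h₂ a b ha hb hab
    simp only [Set.mem_ofPred_eq, Prod.fst_add, Prod.snd_add, Prod.smul_fst, Prod.smul_snd,
      map_add, map_smul, add_apply, smul_apply,
      smul_eq_mul] at h₁ h₂ ⊢
    obtain rfl : b = 1 - a := by linarith
    have := mul_le_mul_of_nonneg_left h₁ ha
    have := mul_le_mul_of_nonneg_left h₂ hb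
    linarith
  have hT : ∀ v ∈ T, ∀ u ∈ convexHull ℝ T, v.1.2 u.1.1 + u.1.2 v.1.1 ≤ v.2 + u.2 := by
    rintro _ ⟨p, hp, rfl⟩ u hu
    refine convexHull_min ?_ (hconv _) hu
    rintro _ ⟨q, hq, rfl⟩
    have := hB.2 p hp q hq
    simp only [map_sub, sub_apply] at this
    simp only [Set.mem_ofPred_eq]
    linarith
  have hmem : T ⊆ {u | w.1.2 u.1.1 + u.1.2 w.1.1 ≤ w.2 + u.2} := by
    intro u hu
    have := hT u hu w hw
    simp only [Set.mem_ofPred_eq]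
    linarith
  have := convexHull_min hmem (hconv w) hw
  simp only [Set.mem_ofPred_eq] at this
  linarith

/-- Separation of the graph of the duality pairing over a monotone set from the hypograph of
`-(1/2)‖x‖² - (1/2)‖x*‖²` by an affine function. -/
lemma MonotoneSet.exists_affine_separation {B : Set (E × (E →L[ℝ] ℝ))} (hB : MonotoneSet B) :
    ∃ (M : E × (E →L[ℝ] ℝ) →L[ℝ] ℝ) (c : ℝ),
      (∀ z, M z - ((1 / 2) * ‖z.1‖ ^ 2 + (1 / 2) * ‖z.2‖ ^ 2) ≤ c) ∧
      ∀ b ∈ B, c ≤ M b + b.2 b.1 := by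
  set g : E × (E →L[ℝ] ℝ) → ℝ := fun z => (1 / 2) * ‖z.1‖ ^ 2 + (1 / 2) * ‖z.2‖ ^ 2 with hg
  have hsq : ∀ (X : Type _) [NormedAddCommGroup X] [NormedSpace ℝ X],
      ConvexOn ℝ Set.univ fun x : X => (1 / 2 : ℝ) * ‖x‖ ^ 2 := fun X _ _ =>
    ((convexOn_univ_norm (E := X)).pow (fun _ _ => norm_nonneg _) 2).smul (by norm_num)
  have hgconv : ConvexOn ℝ Set.univ g :=
    ((hsq E).comp_linearMap (LinearMap.fst ℝ E (E →L[ℝ] ℝ))).add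
      ((hsq (E →L[ℝ] ℝ)).comp_linearMap (LinearMap.snd ℝ E (E →L[ℝ] ℝ)))
  have hopen : IsOpen {w : (E × (E →L[ℝ] ℝ)) × ℝ | w.2 < -g w.1} :=
    isOpen_lt continuous_snd (by fun_prop)
  have hhyp : Convex ℝ {w : (E × (E →L[ℝ] ℝ)) × ℝ | w.2 < -g w.1} := by
    simpa using hgconv.neg.convex_strict_hypograph
  obtain ⟨f, u, hlt, hle⟩ := geometric_hahn_banach_open hhyp hopen
    (convex_convexHull ℝ ((fun b => (b, b.2 b.1)) '' B)) (by
      rw [Set.disjoint_left]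
      intro w hw hw'
      have h₁ := hB.apply_le_of_mem_convexHull hw'
      have h₂ := neg_half_sq_norm_le_apply w.1.1 w.1.2
      simp only [Set.mem_ofPred_eq, hg] at hw
      linarith)
  set L := f.comp (ContinuousLinearMap.inl ℝ (E × (E →L[ℝ] ℝ)) ℝ) with hL
  set α := f (0, 1) with hα
  have hf : ∀ z t, f (z, t) = L z + α * t := by
    intro z t
    have : ((z, t) : (E × (E →L[ℝ] ℝ)) × ℝ) = (z, 0) + t • (0, 1) := by simp
    rw [this, map_add, map_smul, smul_eq_mul, mul_comm]
    rfl
  have hlt' : ∀ z t, t < -g z → L z + α * t < u := fun z t ht => hf z t ▸ hlt (z, t) ht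
  have hle' : ∀ b ∈ B, u ≤ L b + α * b.2 b.1 := fun b hb =>
    hf b _ ▸ hle _ (subset_convexHull ℝ _ ⟨b, hb, rfl⟩)
  have hαpos : 0 < α := by
    obtain ⟨b, hb⟩ := hB.1
    have h₁ := hle' b hb
    have h₂ := hlt' b (-g b - 1 - |b.2 b.1|) (by linarith [abs_nonneg (b.2 b.1)])
    have h₃ := neg_half_sq_norm_le_apply b.1 b.2
    have h₄ : 0 ≤ b.2 b.1 + g b := by simp only [hg]; linarith
    have h₅ : 0 < α * (b.2 b.1 + g b + 1 + |b.2 b.1|) := by linarith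
    exact pos_of_mul_pos_left h₅ (by positivity)
  refine ⟨α⁻¹ • L, α⁻¹ * u, fun z => ?_, fun b hb => ?_⟩
  · have h : L z - α * g z ≤ u := by
      refine le_of_forall_pos_le_add fun ε hε => ?_
      have := hlt' z (-g z - ε / α) (by linarith [div_pos hε hαpos])
      have hc : α * (ε / α) = ε := by field_simp
      linarith
    have := mul_le_mul_of_nonneg_left h (inv_pos.mpr hαpos).le
    rwa [mul_sub, inv_mul_cancel_left₀ hαpos.ne'] at this
  · have := mul_le_mul_of_nonneg_left (hle' b hb) (inv_pos.mpr hαpos).le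
    rwa [mul_add, inv_mul_cancel_left₀ hαpos.ne'] at this

lemma MonotoneSet.exists_forall_rQ_zero_le
    (hrefl : Function.Surjective (NormedSpace.inclusionInDoubleDual ℝ E))
    {B : Set (E × (E →L[ℝ] ℝ))} (hB : MonotoneSet B) :
    ∃ y : E × (E →L[ℝ] ℝ), ∀ b ∈ B, rQ y 0 ≤ (b.2 - y.2) (b.1 - y.1) := by
  obtain ⟨M, c, hM, hc⟩ := hB.exists_affine_separation
  set M₁ := M.comp (ContinuousLinearMap.inl ℝ E (E →L[ℝ] ℝ)) with hM₁
  set M₂ := M.comp (ContinuousLinearMap.inr ℝ E (E →L[ℝ] ℝ)) with hM₂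
  have hsplit : ∀ z, M z = M₁ z.1 + M₂ z.2 := by
    intro z
    simp [hM₁, hM₂, ← map_add]
  obtain ⟨y, hy⟩ := hrefl (-M₂)
  have hyapp : ∀ x' : E →L[ℝ] ℝ, x' y = -M₂ x' := fun x' => by
    simpa using DFunLike.congr_fun hy x'
  have hynorm : ‖y‖ = ‖M₂‖ := by
    rw [← norm_neg M₂, ← hy]
    exact ((NormedSpace.inclusionInDoubleDualLi ℝ).norm_map y).symm
  have hcnorm : (1 / 2) * ‖M₂‖ ^ 2 ≤ c - (1 / 2) * ‖M₁‖ ^ 2 := by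
    refine half_sq_norm_le_of_forall_apply_le M₂ _ fun x' => ?_
    have := half_sq_norm_le_of_forall_apply_le M₁ (c - (M₂ x' - (1 / 2) * ‖x'‖ ^ 2)) fun x => by
      have := hM (x, x')
      rw [hsplit] at this
      linarith
    linarith
  refine ⟨(y, -M₁), fun b hb => ?_⟩
  have h₁ := hc b hb
  have h₂ := hyapp b.2
  rw [hsplit] at h₁
  simp only [rQ, Prod.fst_zero, Prod.snd_zero, sub_zero, norm_neg, hynorm, map_sub,
    sub_apply, neg_apply]
  linarith

lemma MaxMonotone.mem_of_forall {A : Set (E × (E →L[ℝ] ℝ))} (hA : MaxMonotone A)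
    {y : E × (E →L[ℝ] ℝ)} (hy : ∀ a ∈ A, 0 ≤ (a.2 - y.2) (a.1 - y.1)) : y ∈ A := by
  rw [← hA.2 (insert y A) ⟨Set.insert_nonempty y A, ?_⟩ (Set.subset_insert y A)]
  · exact Set.mem_insert y A
  rintro p (rfl | hp) q (rfl | hq)
  · simp
  · have := hy q hq
    rwa [← neg_sub q.2, ← neg_sub q.1, map_neg, neg_apply, neg_neg]
  · exact hy p hp
  · exact hA.1.2 p hp q hq

lemma MaxMonotone.isClosed {A : Set (E × (E →L[ℝ] ℝ))} (hA : MaxMonotone A) : IsClosed A := by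
  have : A = ⋂ a ∈ A, {y | 0 ≤ (a.2 - y.2) (a.1 - y.1)} := by
    refine Set.Subset.antisymm ?_ fun y hy => hA.mem_of_forall (by simpa using hy)
    exact fun y hy => Set.mem_iInter₂.mpr fun a ha => hA.1.2 a ha y hy
  rw [this]
  exact isClosed_biInter fun a _ => isClosed_le continuous_const (by fun_prop)

lemma MaxMonotone.exists_rQ_nonpos
    (hrefl : Function.Surjective (NormedSpace.inclusionInDoubleDual ℝ E))
    {A : Set (E × (E →L[ℝ] ℝ))} (hA : MaxMonotone A) (p : E × (E →L[ℝ] ℝ)) :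
    ∃ q ∈ A, rQ q p ≤ 0 := by
  have hB : MonotoneSet ((fun a => a - p) '' A) := by
    refine ⟨hA.1.1.image _, ?_⟩
    rintro _ ⟨a, ha, rfl⟩ _ ⟨b, hb, rfl⟩
    simpa using hA.1.2 a ha b hb
  obtain ⟨y, hy⟩ := hB.exists_forall_rQ_zero_le hrefl
  have hy' : ∀ a ∈ A, rQ (p + y) p ≤ (a.2 - (p + y).2) (a.1 - (p + y).1) := by
    intro a ha
    simpa [rQ, sub_sub] using hy _ ⟨a, ha, rfl⟩
  have hnonneg : 0 ≤ rQ (p + y) p := by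
    have := neg_half_sq_norm_le_apply ((p + y).1 - p.1) ((p + y).2 - p.2)
    rw [rQ]
    linarith
  have hmem : p + y ∈ A := hA.mem_of_forall fun a ha => hnonneg.trans (hy' a ha)
  exact ⟨p + y, hmem, by simpa using hy' _ hmem⟩

theorem statement10 [CompleteSpace E] [Nontrivial E]
    (hrefl : Function.Surjective (NormedSpace.inclusionInDoubleDual ℝ E))
    (A : Set (E × (E →L[ℝ] ℝ))) (hA : MaxMonotone A) :
    IsClosed A ∧ StablyQuasidense A := by
  refine ⟨hA.isClosed, fun p => ?_⟩
  obtain ⟨q, hq, hqp⟩ := hA.exists_rQ_nonpos hrefl p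
  refine ⟨√(‖q.1 - p.1‖ ^ 2 + ‖q.2 - p.2‖ ^ 2), Real.sqrt_nonneg _, ?_⟩
  exact (iInf₂_le q ⟨hq, le_rfl⟩).trans (by exact_mod_cast hqp)
end
end

section
/- Let k : E → (−∞, ∞] be proper, convex and lower semicontinuous. Then the graph of the subdifferential of k, G(∂k) := {(x, x*) ∈ E × E* : k(x) is finite and ⟨y − x, x*⟩ ≤ k(y) − k(x) for all y ∈ E}, is a stably quasidense and maximally monotone subset of E × E*. -/
noncomputable section

open Filter Topology

variable {E : Type*} [NormedAddCommGroup E] [NormedSpace ℝ E]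

/-- Ekeland's variational principle for a closed set playing the role of an epigraph. -/
theorem IsClosed.exists_ekeland_point {X : Type*} [MetricSpace X] [CompleteSpace X]
    {A : Set (X × ℝ)} (hA : IsClosed A) {m : ℝ} (hm : ∀ p ∈ A, m ≤ p.2)
    {a₀ : X × ℝ} (ha₀ : a₀ ∈ A) {ε : ℝ} (hε : 0 < ε) :
    ∃ p ∈ A, p.2 ≤ a₀.2 ∧ ∀ q ∈ A, p.2 ≤ q.2 + ε * dist q.1 p.1 := by
  have step : ∀ (n : ℕ) (p : A), ∃ q : A, q.1.2 + ε * dist q.1.1 p.1.1 ≤ p.1.2 ∧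
      ∀ z ∈ A, z.2 + ε * dist z.1 p.1.1 ≤ p.1.2 → q.1.2 ≤ z.2 + (1 / 2 : ℝ) ^ n := by
    intro n p
    set S : Set ℝ := {r | ∃ z ∈ A, z.2 + ε * dist z.1 p.1.1 ≤ p.1.2 ∧ z.2 = r} with hS
    have hne : S.Nonempty := ⟨p.1.2, p.1, p.2, by simp, rfl⟩
    have hbdd : BddBelow S := ⟨m, by rintro _ ⟨z, hz, -, rfl⟩; exact hm z hz⟩
    obtain ⟨_, ⟨q, hq, hqp, rfl⟩, hlt⟩ :=
      exists_lt_of_csInf_lt hne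
        (lt_add_of_pos_right (sInf S) (by positivity : (0 : ℝ) < (1 / 2) ^ n))
    refine ⟨⟨q, hq⟩, hqp, fun z hz hzp => ?_⟩
    have := csInf_le hbdd (⟨z, hz, hzp, rfl⟩ : z.2 ∈ S)
    simp only
    linarith
  choose next hnext_le hnext_min using step
  let a : ℕ → A := fun n => Nat.rec ⟨a₀, ha₀⟩ next n
  have trans_le : ∀ {x y z : X × ℝ}, z.2 + ε * dist z.1 y.1 ≤ y.2 →
      y.2 + ε * dist y.1 x.1 ≤ x.2 → z.2 + ε * dist z.1 x.1 ≤ x.2 := by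
    intro x y z h₁ h₂
    have := mul_le_mul_of_nonneg_left (dist_triangle z.1 y.1 x.1) hε.le
    linarith
  have ha_le : ∀ n j, (a (n + j)).1.2 + ε * dist (a (n + j)).1.1 (a n).1.1 ≤ (a n).1.2 := by
    intro n j
    induction j with
    | zero => simp
    | succ j ih => exact trans_le (hnext_le (n + j) (a (n + j))) ih
  have hanti : Antitone fun n => (a n).1.2 := by
    refine antitone_nat_of_succ_le fun n => ?_
    have := ha_le n 1
    have := mul_nonneg hε.le (dist_nonneg (x := (a (n + 1)).1.1) (y := (a n).1.1))
    linarith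
  obtain ⟨r, hr⟩ : ∃ r, Tendsto (fun n => (a n).1.2) atTop (𝓝 r) :=
    ⟨_, tendsto_atTop_ciInf hanti ⟨m, by rintro _ ⟨n, rfl⟩; exact hm _ (a n).2⟩⟩
  have hr_le : ∀ n, r ≤ (a n).1.2 := fun n => hanti.le_of_tendsto hr n
  have hcauchy : CauchySeq fun n => (a n).1.1 := by
    refine cauchySeq_of_le_tendsto_0' (fun n => ((a n).1.2 - r) / ε) (fun n j hnj => ?_) ?_
    · obtain ⟨i, rfl⟩ := Nat.exists_eq_add_of_le hnj
      rw [le_div_iff₀ hε, dist_comm]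
      linarith [ha_le n i, hr_le (n + i)]
    · simpa using (hr.sub_const r).div_const ε
  obtain ⟨x, hx⟩ := cauchySeq_tendsto_of_complete hcauchy
  have hp : Tendsto (fun n => (a n).1) atTop (𝓝 (x, r)) := hx.prodMk_nhds hr
  have hp_le : ∀ n, r + ε * dist x (a n).1.1 ≤ (a n).1.2 := by
    intro n
    have hlim : Tendsto (fun j => (a j).1.2 + ε * dist (a j).1.1 (a n).1.1) atTop
        (𝓝 (r + ε * dist x (a n).1.1)) := hr.add ((hx.dist tendsto_const_nhds).const_mul ε)
    refine le_of_tendsto hlim ((eventually_ge_atTop n).mono fun j hj => ?_)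
    obtain ⟨i, rfl⟩ := Nat.exists_eq_add_of_le hj
    exact ha_le n i
  refine ⟨(x, r), hA.mem_of_tendsto hp (.of_forall fun n => (a n).2), hr_le 0, fun q hq => ?_⟩
  by_contra! hlt
  have hq_le : ∀ n, (a (n + 1)).1.2 ≤ q.2 + (1 / 2 : ℝ) ^ n := fun n =>
    hnext_min n (a n) q hq (trans_le (y := (x, r)) hlt.le (hp_le n))
  have hlim : Tendsto (fun n : ℕ => q.2 + (1 / 2 : ℝ) ^ n) atTop (𝓝 (q.2 + 0)) :=
    (tendsto_pow_atTop_nhds_zero_of_lt_one (by norm_num) (by norm_num)).const_add q.2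
  have hrq : r ≤ q.2 + 0 :=
    le_of_tendsto_of_tendsto' ((tendsto_add_atTop_iff_nat 1).2 hr) hlim hq_le
  have := mul_nonneg hε.le (dist_nonneg (x := q.1) (y := x))
  simp only at hlt
  linarith

/-- Sandwich theorem: an affine function separates a convex epigraph from a continuous
concave function lying below it. -/
theorem Convex.exists_affine_between {A : Set (E × ℝ)} (hA : Convex ℝ A) (hne : A.Nonempty)
    {g : E → ℝ} (hg : ConvexOn ℝ Set.univ g) (hgc : Continuous g)
    (hAg : ∀ p ∈ A, 0 ≤ p.2 + g p.1) :
    ∃ (φ : E →L[ℝ] ℝ) (c : ℝ), (∀ p ∈ A, φ p.1 + c ≤ p.2) ∧ ∀ x, -g x ≤ φ x + c := by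
  have hUo : IsOpen {p : E × ℝ | p.2 < -g p.1} :=
    isOpen_lt continuous_snd (hgc.comp continuous_fst).neg
  have hUc : Convex ℝ {p : E × ℝ | p.2 < -g p.1} := by
    simpa using hg.neg.convex_strict_hypograph
  obtain ⟨f, u, hf₁, hf₂⟩ := geometric_hahn_banach_open hUc hUo hA <|
    Set.disjoint_left.2 fun p hp hpA => by
      have h₁ : p.2 < -g p.1 := hp
      linarith [hAg p hpA]
  have hf : ∀ x r, f (x, r) = f (x, 0) + r * f (0, 1) := fun x r => by
    rw [← smul_eq_mul, ← map_smul, ← map_add]; simp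
  set α := f (0, 1) with hα
  obtain ⟨⟨x₀, r₀⟩, h₀⟩ := hne
  have hα_pos : 0 < α := by
    have h₁ := hf₁ (x₀, -g x₀ - 1) (by simp)
    have h₂ := hf₂ _ h₀
    have h₃ := hAg _ h₀
    rw [hf] at h₁ h₂
    simp only at h₃
    by_contra! hneg
    nlinarith
  refine ⟨-(α⁻¹ • f.comp (ContinuousLinearMap.inl ℝ E ℝ)), u / α, fun ⟨x, r⟩ hp => ?_, fun x => ?_⟩
  · have h := hf₂ _ hp
    rw [hf] at h
    have : (u - f (x, 0)) / α ≤ r := by rw [div_le_iff₀ hα_pos]; linarith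
    calc _ = (u - f (x, 0)) / α := by simp; ring
      _ ≤ r := this
  · have : -g x ≤ (u - f (x, 0)) / α := by
      refine le_of_forall_lt fun r hr => ?_
      have h := hf₁ (x, r) hr
      rw [hf] at h
      rw [lt_div_iff₀ hα_pos]; linarith
    calc -g x ≤ (u - f (x, 0)) / α := this
      _ = _ := by simp; ring

/-- A perturbed minimizer of a quadratic regularization has a dual element at which `rQ` is
small. -/
theorem rQ_le_of_regularized_min {x x₀ : E} {s φ : E →L[ℝ] ℝ} {ε : ℝ} (hε : 0 ≤ ε)
    (h : ∀ y, (1 / 2) * ‖x - x₀‖ ^ 2 + (φ - s) (y - x) ≤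
      (1 / 2) * ‖y - x₀‖ ^ 2 + ε * ‖y - x‖) :
    ‖s - φ‖ ≤ ‖x - x₀‖ + ε ∧ rQ (x, s) (x₀, φ) ≤ 2 * ε * ‖x - x₀‖ + ε ^ 2 / 2 := by
  set d := x - x₀ with hd
  have hdir : ∀ v : E, (φ - s) v ≤ (‖d‖ + ε) * ‖v‖ := by
    intro v
    refine le_of_forall_pos_le_add fun δ hδ => ?_
    obtain ⟨t, ht, htδ⟩ : ∃ t : ℝ, 0 < t ∧ t * ‖v‖ ^ 2 ≤ 2 * δ := by
      refine ⟨2 * δ / (‖v‖ ^ 2 + 1), by positivity, ?_⟩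
      rw [div_mul_eq_mul_div, div_le_iff₀ (by positivity)]
      nlinarith
    have h₁ := h (x + t • v)
    have h₂ : x + t • v - x₀ = d + t • v := by rw [hd]; abel
    have h₃ : ‖d + t • v‖ ≤ ‖d‖ + t * ‖v‖ :=
      (norm_add_le _ _).trans_eq (by rw [norm_smul, Real.norm_of_nonneg ht.le])
    have h₄ : ‖d + t • v‖ ^ 2 ≤ (‖d‖ + t * ‖v‖) ^ 2 := by gcongr
    rw [h₂, add_sub_cancel_left, map_smul, smul_eq_mul, norm_smul,
      Real.norm_of_nonneg ht.le] at h₁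
    have h₅ : t * (φ - s) v ≤ t * ((‖d‖ + ε) * ‖v‖ + δ) := by nlinarith
    exact le_of_mul_le_mul_left h₅ ht
  have hnorm : ‖s - φ‖ ≤ ‖d‖ + ε := by
    refine ContinuousLinearMap.opNorm_le_bound _ (by positivity) fun v => ?_
    rw [Real.norm_eq_abs, abs_le]
    have h₁ := hdir v
    have h₂ := hdir (-v)
    simp only [sub_apply, map_neg, norm_neg] at h₁ h₂ ⊢
    constructor <;> linarith
  have hinner : (s - φ) d ≤ ε * ‖d‖ - ‖d‖ ^ 2 := by
    refine le_of_forall_pos_le_add fun δ hδ => ?_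
    obtain ⟨t, ht, ht₁, htδ⟩ : ∃ t : ℝ, 0 < t ∧ t ≤ 1 ∧ t * ‖d‖ ^ 2 ≤ 2 * δ := by
      refine ⟨min 1 (2 * δ / (‖d‖ ^ 2 + 1)), by positivity, min_le_left _ _, ?_⟩
      calc _ ≤ 2 * δ / (‖d‖ ^ 2 + 1) * ‖d‖ ^ 2 := by gcongr; exact min_le_right _ _
        _ ≤ 2 * δ := by rw [div_mul_eq_mul_div, div_le_iff₀ (by positivity)]; nlinarith
    have h₁ := h (x - t • d)
    have h₂ : x - t • d - x₀ = (1 - t) • d := by rw [sub_smul, one_smul, hd]; abel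
    rw [h₂, sub_sub_cancel_left, map_neg, map_smul, smul_eq_mul, norm_neg, norm_smul, norm_smul,
      Real.norm_of_nonneg ht.le, Real.norm_of_nonneg (sub_nonneg.2 ht₁)] at h₁
    have h₃ : t * (s - φ) d ≤ t * (ε * ‖d‖ - ‖d‖ ^ 2 + δ) := by
      simp only [sub_apply] at h₁ ⊢
      nlinarith
    exact le_of_mul_le_mul_left h₃ ht
  refine ⟨hnorm, ?_⟩
  have hsq : ‖s - φ‖ ^ 2 ≤ (‖d‖ + ε) ^ 2 := by gcongr
  simp only [rQ]
  nlinarith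

theorem convex_real_epigraph {k : E → EReal}
    (hconv : ∀ x y : E, ∀ t : ℝ, 0 ≤ t → t ≤ 1 →
      k (t • x + (1 - t) • y) ≤ (t : EReal) * k x + ((1 - t : ℝ) : EReal) * k y) :
    Convex ℝ {p : E × ℝ | k p.1 ≤ p.2} := by
  rintro ⟨x, r⟩ hx ⟨y, t⟩ hy a b ha hb hab
  obtain rfl : b = 1 - a := by linarith
  simp only [Set.mem_ofPred_eq, Prod.smul_mk, Prod.mk_add_mk, smul_eq_mul] at *
  refine (hconv x y a ha (by linarith)).trans ?_
  rw [EReal.coe_add, EReal.coe_mul, EReal.coe_mul]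
  exact add_le_add (mul_le_mul_of_nonneg_left hx (by exact_mod_cast ha))
    (mul_le_mul_of_nonneg_left hy (by exact_mod_cast hb))

theorem LowerSemicontinuous.isClosed_real_epigraph {X : Type*} [TopologicalSpace X]
    {k : X → EReal} (hlsc : LowerSemicontinuous k) : IsClosed {p : X × ℝ | k p.1 ≤ p.2} :=
  hlsc.isClosed_epigraph.preimage
    (continuous_fst.prodMk (continuous_coe_real_ereal.comp continuous_snd))

/-- A closed convex epigraph with a finite value lies above a cone. -/
theorem Convex.exists_cone_le {A : Set (E × ℝ)} (hA : Convex ℝ A) (hAc : IsClosed A)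
    {x₀ : E} {r₀ : ℝ} (h₀ : (x₀, r₀) ∈ A) (hup : ∀ x r t, (x, r) ∈ A → r ≤ t → (x, t) ∈ A)
    {c : ℝ} (hc : (x₀, c) ∉ A) :
    ∃ b ≥ 0, ∀ p ∈ A, c - b * ‖p.1 - x₀‖ ≤ p.2 := by
  have hcr : c < r₀ := by
    by_contra! h
    exact hc (hup _ _ _ h₀ h)
  have hev : ∀ᶠ y in 𝓝 x₀, (y, c) ∉ A :=
    (Continuous.prodMk_left c).continuousAt.eventually (hAc.isOpen_compl.mem_nhds hc)
  obtain ⟨δ, hδ, hball⟩ := Metric.eventually_nhds_iff.1 hev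
  refine ⟨2 * (r₀ - c) / δ, by have := sub_pos.2 hcr; positivity, fun ⟨x, r⟩ hp => ?_⟩
  simp only
  by_contra! hlt
  have hb : 0 < 2 * (r₀ - c) / δ := by have := sub_pos.2 hcr; positivity
  have hrc : r < c := by nlinarith [norm_nonneg (x - x₀)]
  have hpos : 0 < r₀ - r := by linarith
  -- The chord from `(x₀, r₀)` to `(x, r)` passes level `c` close to `x₀`.
  set t := (r₀ - c) / (r₀ - r) with ht
  have ht₀ : 0 ≤ t := by have := sub_pos.2 hcr; positivity
  have ht₁ : t ≤ 1 := by rw [ht, div_le_one hpos]; linarith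
  have hmem := hA hp h₀ ht₀ (sub_nonneg.2 ht₁) (by ring)
  have hlevel : t * r + (1 - t) * r₀ = c := by rw [ht]; field_simp; ring
  simp only [Prod.smul_mk, Prod.mk_add_mk, smul_eq_mul, hlevel] at hmem
  refine hball ?_ hmem
  rw [dist_eq_norm, show t • x + (1 - t) • x₀ - x₀ = t • (x - x₀) by module, norm_smul,
    Real.norm_of_nonneg ht₀, ht, div_mul_eq_mul_div, div_lt_iff₀ hpos]
  have : 2 * (r₀ - c) / δ * ‖x - x₀‖ < r₀ - r := by linarith
  rw [div_mul_eq_mul_div, div_lt_iff₀ hδ] at this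
  nlinarith [norm_nonneg (x - x₀)]

/-- The graph of the subdifferential in terms of the real epigraph. -/
theorem mem_subdifferential_graph_iff {k : E → EReal} (hbot : ∀ x, k x ≠ ⊥) {x : E}
    {s : E →L[ℝ] ℝ} (hdom : ∃ x, k x ≠ ⊤) :
    (k x ≠ ⊤ ∧ ∀ y : E, ((s (y - x) : ℝ) : EReal) ≤ k y - k x) ↔
      ∀ (y : E) (t : ℝ), k y ≤ t → k x ≤ ((t - s (y - x) : ℝ) : EReal) := by
  constructor
  · rintro ⟨hx, h⟩ y t hy
    have h₁ := h y
    lift k x to ℝ using ⟨hx, hbot x⟩ with a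
    have h₂ : ((s (y - x) : ℝ) : EReal) ≤ (t : EReal) - a := h₁.trans (EReal.sub_le_sub hy le_rfl)
    norm_cast at h₂ ⊢
    linarith
  · intro h
    obtain ⟨y, hy⟩ := hdom
    have hx : k x ≠ ⊤ := fun hx => by
      have := h y (k y).toReal (EReal.le_coe_toReal hy)
      rw [hx] at this
      exact EReal.coe_ne_top _ (top_le_iff.1 this)
    refine ⟨hx, fun y => ?_⟩
    by_cases hy : k y = ⊤
    · lift k x to ℝ using ⟨hx, hbot x⟩ with a
      rw [hy, EReal.top_sub_coe]
      exact le_top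
    · have := h y (k y).toReal (EReal.le_coe_toReal hy)
      lift k y to ℝ using ⟨hy, hbot y⟩ with b
      lift k x to ℝ using ⟨hx, hbot x⟩ with a
      rw [EReal.toReal_coe] at this
      norm_cast at this ⊢
      linarith

theorem subdifferential_graph_stablyQuasidense [CompleteSpace E]
    {k : E → EReal} (hbot : ∀ x, k x ≠ ⊥) (hproper : ∃ x, k x ≠ ⊤)
    (hconv : ∀ x y : E, ∀ t : ℝ, 0 ≤ t → t ≤ 1 →
      k (t • x + (1 - t) • y) ≤ (t : EReal) * k x + ((1 - t : ℝ) : EReal) * k y)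
    (hlsc : LowerSemicontinuous k) :
    StablyQuasidense {p : E × (E →L[ℝ] ℝ) | k p.1 ≠ ⊤ ∧
      ∀ y : E, ((p.2 (y - p.1) : ℝ) : EReal) ≤ k y - k p.1} := by
  rintro ⟨x₀, φ⟩
  have hA := convex_real_epigraph hconv
  have hAc := hlsc.isClosed_real_epigraph
  set A : Set (E × ℝ) := {p | k p.1 ≤ p.2} with hAdef
  obtain ⟨z, hz⟩ := hproper
  obtain ⟨ρ, hρ⟩ : ∃ ρ : ℝ, k z = ρ := ⟨(k z).toReal, (EReal.coe_toReal hz (hbot z)).symm⟩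
  have hzA : (z, ρ) ∈ A := hρ.le
  obtain ⟨b, hb, hcone⟩ := hA.exists_cone_le hAc hzA (c := ρ - 1)
    (fun x r t hr hrt => show k x ≤ t from le_trans hr (EReal.coe_le_coe_iff.2 hrt))
    (by simp only [hAdef, Set.mem_ofPred_eq, hρ]; norm_cast; linarith)
  set h : E → ℝ := fun y => (1 / 2) * ‖y - x₀‖ ^ 2 - φ y with hh
  have hhc : Continuous h := by fun_prop
  -- A quadratic minorant of the regularized function.
  obtain ⟨C, B, hB, hquad⟩ : ∃ C B : ℝ, 0 ≤ B ∧ ∀ p ∈ A,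
      C - B * ‖p.1 - x₀‖ + (1 / 2) * ‖p.1 - x₀‖ ^ 2 ≤ p.2 + h p.1 := by
    refine ⟨ρ - 1 - b * ‖x₀ - z‖ - φ x₀, b + ‖φ‖, by positivity, fun p hp => ?_⟩
    have h₁ := hcone p hp
    have h₂ : b * ‖p.1 - z‖ ≤ b * (‖p.1 - x₀‖ + ‖x₀ - z‖) :=
      mul_le_mul_of_nonneg_left (norm_sub_le_norm_sub_add_norm_sub _ _ _) hb
    have h₃ : φ p.1 - φ x₀ ≤ ‖φ‖ * ‖p.1 - x₀‖ := by
      rw [← map_sub]; exact (le_abs_self _).trans (φ.le_opNorm _)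
    simp only [hh]
    linarith
  set R := ρ + h z with hR
  set D := 2 * B + 2 * |R - C| + 2 with hD
  have hDpos : 0 ≤ D := by positivity
  refine ⟨2 * D + 1, by positivity, ?_⟩
  refine EReal.le_of_forall_lt_iff_le.1 fun η hη => ?_
  have hη' : 0 < η := by exact_mod_cast hη
  obtain ⟨ε, hε, hε₁, hεη⟩ : ∃ ε : ℝ, 0 < ε ∧ ε ≤ 1 ∧ (2 * D + 1) * ε ≤ η := by
    refine ⟨min 1 (η / (2 * D + 1)), by positivity, min_le_left _ _, ?_⟩
    rw [mul_comm, ← le_div_iff₀ (by positivity)]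
    exact min_le_right _ _
  have hA'c : IsClosed {p : E × ℝ | (p.1, p.2 - h p.1) ∈ A} :=
    hAc.preimage (by fun_prop)
  obtain ⟨⟨x, r⟩, hxr, hrle, hmin⟩ := hA'c.exists_ekeland_point (m := C - B ^ 2 / 2)
    (fun p hp => by
      have := hquad _ hp
      simp only at this
      nlinarith [sq_nonneg (‖p.1 - x₀‖ - B)])
    (a₀ := (z, R)) (by simpa [hR] using hzA) hε
  simp only [Set.mem_ofPred_eq] at hxr hrle hmin
  have hmin' : ∀ p ∈ A, 0 ≤ p.2 + (h p.1 + ε * ‖p.1 - x‖ - r) := fun p hp => by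
    have := hmin (p.1, p.2 + h p.1) (by simpa using hp)
    rw [dist_eq_norm] at this
    simp only at this
    linarith
  have hnorm_convex : ∀ a : E, ConvexOn ℝ Set.univ fun y : E => ‖y - a‖ := fun a => by
    simpa [dist_eq_norm] using convexOn_univ_dist a
  have hg : ConvexOn ℝ Set.univ fun y => h y + ε * ‖y - x‖ - r := by
    have h₁ := ((hnorm_convex x₀).pow (fun _ _ => norm_nonneg _) 2).smul (c := (1 / 2 : ℝ))
      (by norm_num)
    have h₂ := (hnorm_convex x).smul hε.le
    have h₃ := (φ : E →ₗ[ℝ] ℝ).concaveOn (convex_univ)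
    exact ((h₁.sub h₃).add h₂).sub (concaveOn_const r convex_univ)
  obtain ⟨s, c, hs₁, hs₂⟩ := hA.exists_affine_between ⟨_, hzA⟩ hg (by fun_prop) hmin'
  have hx₁ := hs₁ _ hxr
  have hx₂ := hs₂ x
  simp only [sub_self, norm_zero, mul_zero, add_zero] at hx₁ hx₂
  obtain ⟨hnorm, hrQ⟩ := rQ_le_of_regularized_min (x := x) (x₀ := x₀) (s := s) (φ := φ) hε.le
    fun y => by
      have := hs₂ y
      simp only [hh, map_sub, sub_apply] at *
      linarith
  have hdist : ‖x - x₀‖ ≤ D := by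
    have h₁ := hquad _ hxr
    simp only at h₁
    have h₂ := le_abs_self (R - C)
    have h₃ := abs_nonneg (R - C)
    by_contra! hlt
    nlinarith [mul_pos (show 0 < ‖x - x₀‖ by linarith) (sub_pos.2 hlt)]
  have hmem : (x, s) ∈ {p : E × (E →L[ℝ] ℝ) | k p.1 ≠ ⊤ ∧
      ∀ y : E, ((p.2 (y - p.1) : ℝ) : EReal) ≤ k y - k p.1} := by
    refine (mem_subdifferential_graph_iff hbot ⟨z, hz⟩).2 fun y t hy => ?_
    have h₁ := hs₁ (y, t) hy
    simp only at h₁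
    refine le_trans hxr (EReal.coe_le_coe_iff.2 ?_)
    rw [map_sub]
    simp only
    linarith
  have hK : Real.sqrt (‖x - x₀‖ ^ 2 + ‖s - φ‖ ^ 2) ≤ 2 * D + 1 := by
    refine Real.sqrt_le_iff.2 ⟨by positivity, ?_⟩
    have h₁ : ‖s - φ‖ ≤ D + 1 := by linarith
    have h₂ : ‖s - φ‖ ^ 2 ≤ (D + 1) ^ 2 := by gcongr
    have h₃ : ‖x - x₀‖ ^ 2 ≤ D ^ 2 := by gcongr
    nlinarith
  refine (iInf₂_le (x, s) ⟨hmem, hK⟩).trans (EReal.coe_le_coe_iff.2 (hrQ.trans ?_))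
  nlinarith

theorem StablyQuasidense.exists_rQ_lt {A : Set (E × (E →L[ℝ] ℝ))} (hA : StablyQuasidense A)
    (p : E × (E →L[ℝ] ℝ)) {ε : ℝ} (hε : 0 < ε) : ∃ q ∈ A, rQ q p < ε := by
  obtain ⟨K, -, hK⟩ := hA p
  have hlt := hK.trans_lt (show (0 : EReal) < (ε : EReal) by exact_mod_cast hε)
  simp only [iInf_lt_iff] at hlt
  obtain ⟨q, hq, hlt⟩ := hlt
  exact ⟨q, hq.1, by exact_mod_cast hlt⟩

/-- A closed, monotone, stably quasidense set is maximally monotone. -/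
theorem StablyQuasidense.maxMonotone {A : Set (E × (E →L[ℝ] ℝ))} (hA : StablyQuasidense A)
    (hclosed : IsClosed A) (hmono : ∀ p ∈ A, ∀ q ∈ A, 0 ≤ (p.2 - q.2) (p.1 - q.1)) :
    MaxMonotone A := by
  refine ⟨⟨?_, hmono⟩, fun A' hA' hsub => (hsub.antisymm fun p hp => ?_).symm⟩
  · obtain ⟨q, hq, -⟩ := hA.exists_rQ_lt 0 one_pos
    exact ⟨q, hq⟩
  refine hclosed.closure_subset (Metric.mem_closure_iff.2 fun ε hε => ?_)
  obtain ⟨q, hq, hlt⟩ := hA.exists_rQ_lt p (show 0 < ε ^ 2 / 2 by positivity)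
  have h := hA'.2 q (hsub hq) p hp
  simp only [rQ] at hlt
  refine ⟨q, hq, ?_⟩
  rw [dist_comm, dist_eq_norm, Prod.norm_def, max_lt_iff, Prod.fst_sub, Prod.snd_sub]
  constructor <;> refine lt_of_pow_lt_pow_left₀ 2 hε.le ?_ <;>
    nlinarith [sq_nonneg ‖q.1 - p.1‖, sq_nonneg ‖q.2 - p.2‖]

theorem isClosed_subdifferential_graph {k : E → EReal} (hbot : ∀ x, k x ≠ ⊥)
    (hproper : ∃ x, k x ≠ ⊤) (hlsc : LowerSemicontinuous k) :
    IsClosed {p : E × (E →L[ℝ] ℝ) | k p.1 ≠ ⊤ ∧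
      ∀ y : E, ((p.2 (y - p.1) : ℝ) : EReal) ≤ k y - k p.1} := by
  simp only [mem_subdifferential_graph_iff hbot hproper, Set.ofPred_forall]
  refine isClosed_iInter fun y => isClosed_iInter fun t => isClosed_iInter fun _ => ?_
  exact hlsc.isClosed_real_epigraph.preimage
    (f := fun p : E × (E →L[ℝ] ℝ) => (p.1, t - p.2 (y - p.1))) (by fun_prop)

theorem subdifferential_graph_monotone {k : E → EReal} (hbot : ∀ x, k x ≠ ⊥)
    {p q : E × (E →L[ℝ] ℝ)}
    (hp : k p.1 ≠ ⊤ ∧ ∀ y : E, ((p.2 (y - p.1) : ℝ) : EReal) ≤ k y - k p.1)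
    (hq : k q.1 ≠ ⊤ ∧ ∀ y : E, ((q.2 (y - q.1) : ℝ) : EReal) ≤ k y - k q.1) :
    0 ≤ (p.2 - q.2) (p.1 - q.1) := by
  have h₁ := hp.2 q.1
  have h₂ := hq.2 p.1
  lift k p.1 to ℝ using ⟨hp.1, hbot _⟩ with a
  lift k q.1 to ℝ using ⟨hq.1, hbot _⟩ with b
  norm_cast at h₁ h₂
  simp only [map_sub, sub_apply] at *
  linarith

theorem statement11 [CompleteSpace E] [Nontrivial E]
    (k : E → EReal) (hbot : ∀ x, k x ≠ ⊥) (hproper : ∃ x, k x ≠ ⊤)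
    (hconv : ∀ x y : E, ∀ t : ℝ, 0 ≤ t → t ≤ 1 →
      k (t • x + (1 - t) • y) ≤ (t : EReal) * k x + ((1 - t : ℝ) : EReal) * k y)
    (hlsc : LowerSemicontinuous k) :
    StablyQuasidense {p : E × (E →L[ℝ] ℝ) | k p.1 ≠ ⊤ ∧
        ∀ y : E, ((p.2 (y - p.1) : ℝ) : EReal) ≤ k y - k p.1} ∧
    MaxMonotone {p : E × (E →L[ℝ] ℝ) | k p.1 ≠ ⊤ ∧
        ∀ y : E, ((p.2 (y - p.1) : ℝ) : EReal) ≤ k y - k p.1} := by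
  have hqd := subdifferential_graph_stablyQuasidense hbot hproper hconv hlsc
  exact ⟨hqd, hqd.maxMonotone (isClosed_subdifferential_graph hbot hproper hlsc)
    fun _ hp _ hq => subdifferential_graph_monotone hbot hp hq⟩
end
end

section
/- Let A ⊆ E × E* be maximally monotone and surjective in the sense that for every x* ∈ E* there exists x ∈ E with (x, x*) ∈ A. Then A is stably quasidense. -/
noncomputable section

open Filter Topology

variable {E : Type*} [NormedAddCommGroup E] [NormedSpace ℝ E]

/-- Up to `ε`, the conjugate of half the squared norm is half the squared dual norm. -/
lemma exists_half_sq_norm_le (k : E →L[ℝ] ℝ) {ε : ℝ} (hε : 0 < ε) :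
    ∃ x : E, 1 / 2 * ‖x‖ ^ 2 + 1 / 2 * ‖k‖ ^ 2 - k x ≤ ε := by
  rcases eq_or_lt_of_le (norm_nonneg k) with h | h
  · exact ⟨0, by simp [← h, hε.le]⟩
  · have hlt : ‖k‖ - ε / ‖k‖ < ‖k‖ := sub_lt_self _ (div_pos hε h)
    obtain ⟨x, hx1, hx⟩ := k.exists_lt_apply_of_lt_opNorm hlt
    obtain ⟨y, hy1, hy⟩ : ∃ y : E, ‖y‖ < 1 ∧ ‖k‖ - ε / ‖k‖ < k y := by
      rcases le_total 0 (k x) with h0 | h0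
      · exact ⟨x, hx1, by rwa [Real.norm_of_nonneg h0] at hx⟩
      · exact ⟨-x, by rwa [norm_neg], by rwa [Real.norm_of_nonpos h0, ← map_neg] at hx⟩
    refine ⟨‖k‖ • y, ?_⟩
    have h1 : ‖k‖ * (‖k‖ - ε / ‖k‖) ≤ ‖k‖ * k y := mul_le_mul_of_nonneg_left hy.le h.le
    have h2 : ‖k‖ * (‖k‖ - ε / ‖k‖) = ‖k‖ ^ 2 - ε := by field_simp
    have h3 : ‖(‖k‖ • y)‖ ^ 2 ≤ ‖k‖ ^ 2 := by
      rw [norm_smul, norm_norm]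
      gcongr
      nlinarith [norm_nonneg y]
    rw [map_smul, smul_eq_mul]
    linarith

lemma sq_norm_convexOn {F : Type*} [NormedAddCommGroup F] [NormedSpace ℝ F] :
    ConvexOn ℝ Set.univ (fun x : F => ‖x‖ ^ 2) :=
  (convexOn_norm convex_univ).pow (fun _ _ => norm_nonneg _) 2

/-- For a monotone surjective set, the infimum of the Fitzpatrick function of the translate by `p`
plus half the squared norm is nonpositive. -/
lemma exists_fitzpatrick_add_half_sq_norm_le {A : Set (E × (E →L[ℝ] ℝ))} (hA : MonotoneSet A)
    (hsurj : ∀ x' : E →L[ℝ] ℝ, ∃ x : E, (x, x') ∈ A) (p : E × (E →L[ℝ] ℝ)) {ε : ℝ}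
    (hε : 0 < ε) :
    ∃ z : E × (E →L[ℝ] ℝ), ∀ a ∈ A, rQ z p - (z.2 - a.2) (z.1 - a.1) ≤ ε := by
  let C : Set ((E × (E →L[ℝ] ℝ)) × ℝ) := {y | ∀ a ∈ A,
    (a.2 - p.2) y.1.1 + y.1.2 (a.1 - p.1) - (a.2 - p.2) (a.1 - p.1) ≤ y.2}
  let H : Set ((E × (E →L[ℝ] ℝ)) × ℝ) :=
    {y | y.2 + (‖y.1.1‖ ^ 2 / 2 + ‖y.1.2‖ ^ 2 / 2) < ε}
  have hC : Convex ℝ C := by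
    intro y hy w hw α β hα hβ hαβ a ha
    have h1 := mul_le_mul_of_nonneg_left (hy a ha) hα
    have h2 := mul_le_mul_of_nonneg_left (hw a ha) hβ
    simp only [Prod.fst_add, Prod.snd_add, Prod.smul_fst, Prod.smul_snd, map_add, map_smul,
      smul_eq_mul, add_apply, smul_apply] at *
    obtain rfl : β = 1 - α := by linarith
    linarith
  have hH : Convex ℝ H := by
    intro y hy w hw α β hα hβ hαβ
    have h1 := sq_norm_convexOn.2 (Set.mem_univ y.1.1) (Set.mem_univ w.1.1) hα hβ hαβ
    have h2 := sq_norm_convexOn.2 (Set.mem_univ y.1.2) (Set.mem_univ w.1.2) hα hβ hαβ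
    simp only [H, Set.mem_ofPred_eq, Prod.fst_add, Prod.snd_add, Prod.smul_fst, Prod.smul_snd,
      smul_eq_mul] at *
    rcases eq_or_lt_of_le hα with rfl | hα'
    · obtain rfl : β = 1 := by linarith
      linarith
    · have h3 := mul_lt_mul_of_pos_left hy hα'
      have h4 := mul_le_mul_of_nonneg_left hw.le hβ
      obtain rfl : β = 1 - α := by linarith
      linarith
  have hHo : IsOpen H := isOpen_lt (by fun_prop) continuous_const
  by_contra! hcon
  have hdisj : Disjoint H C := by
    rw [Set.disjoint_left]
    intro y hyH hyC
    obtain ⟨a, ha, hlt⟩ := hcon (p + y.1)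
    have h1 := hyC a ha
    simp only [H, Set.mem_ofPred_eq] at hyH
    simp only [rQ, Prod.fst_add, Prod.snd_add, add_sub_cancel_left] at hlt
    have h2 : (p.2 + y.1.2 - a.2) (p.1 + y.1.1 - a.1) = y.1.2 y.1.1
        - ((a.2 - p.2) y.1.1 + y.1.2 (a.1 - p.1) - (a.2 - p.2) (a.1 - p.1)) := by
      simp only [map_add, map_sub, add_apply, sub_apply]
      ring
    linarith
  obtain ⟨f, u, hfH, hfC⟩ := geometric_hahn_banach_open hH hHo hC hdisj
  have memC : ∀ a ∈ A, ((a - p, (a.2 - p.2) (a.1 - p.1)) : (E × (E →L[ℝ] ℝ)) × ℝ) ∈ C := by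
    intro a ha b hb
    have h := hA.2 a ha b hb
    simp only [Prod.fst_sub, Prod.snd_sub, map_sub, sub_apply] at *
    linarith
  have hf : ∀ z t, f (z, t) = f (z, 0) + t * f (0, 1) := by
    intro z t
    rw [← smul_eq_mul, ← map_smul, ← map_add]
    simp
  have hα : 0 < f (0, 1) := by
    obtain ⟨a, ha⟩ := hA.1
    have h1 := hfC _ (memC a ha)
    set z := a - p
    set t := (a.2 - p.2) (a.1 - p.1)
    have hmin1 := min_le_left t (ε - (‖z.1‖ ^ 2 / 2 + ‖z.2‖ ^ 2 / 2))
    have hmin2 := min_le_right t (ε - (‖z.1‖ ^ 2 / 2 + ‖z.2‖ ^ 2 / 2))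
    set m := min t (ε - (‖z.1‖ ^ 2 / 2 + ‖z.2‖ ^ 2 / 2))
    have h2 := hfH (z, m - 1) (by simp only [H, Set.mem_ofPred_eq]; linarith)
    rw [hf] at h1 h2
    by_contra! hneg
    nlinarith
  let k : E →L[ℝ] ℝ := (f (0, 1))⁻¹ • (f.comp (.inl ℝ _ ℝ)).comp (.inl ℝ E (E →L[ℝ] ℝ))
  have hk : ∀ x, f ((x, 0), 0) = f (0, 1) * k x := by
    intro x
    simp [k, hα.ne']
  obtain ⟨x, hx⟩ := exists_half_sq_norm_le k (half_pos hε)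
  obtain ⟨s, hs⟩ := hsurj (p.2 - k)
  have h1 := hfC _ (memC _ hs)
  have h2 := hfH ((x, -k), ε / 2 - (‖x‖ ^ 2 / 2 + ‖k‖ ^ 2 / 2))
    (by simp only [H, Set.mem_ofPred_eq, norm_neg]; linarith)
  have hsplit : ∀ y, f ((y, -k), 0) = f (0, 1) * k y + f ((0, -k), 0) := by
    intro y
    rw [← hk, ← map_add]
    simp
  have hsp : (s, p.2 - k) - p = (s - p.1, -k) := by ext <;> simp
  rw [hsp, hf, hsplit] at h1
  rw [hf, hsplit] at h2
  simp only [sub_sub_cancel_left, neg_apply] at h1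
  have h3 : 0 ≤ f (0, 1) * (ε / 2 - (1 / 2 * ‖x‖ ^ 2 + 1 / 2 * ‖k‖ ^ 2 - k x)) :=
    mul_nonneg hα.le (by linarith)
  nlinarith

lemma MaxMonotone.mem_of_apply_sub_nonneg {A : Set (E × (E →L[ℝ] ℝ))} (hA : MaxMonotone A)
    {z : E × (E →L[ℝ] ℝ)} (h : ∀ a ∈ A, 0 ≤ (z.2 - a.2) (z.1 - a.1)) : z ∈ A := by
  have hmon : MonotoneSet (insert z A) := by
    refine ⟨Set.insert_nonempty _ _, ?_⟩
    rintro a (rfl | ha) b (rfl | hb)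
    · simp
    · exact h b hb
    · have := h a ha
      simp only [map_sub, sub_apply] at *
      linarith
    · exact hA.1.2 a ha b hb
  exact hA.2 _ hmon (Set.subset_insert _ _) ▸ Set.mem_insert _ _

/-- A maximally monotone set has points which are nonpositively related to any given point. -/
lemma MaxMonotone.exists_apply_sub_nonpos {A : Set (E × (E →L[ℝ] ℝ))} (hA : MaxMonotone A)
    (z : E × (E →L[ℝ] ℝ)) : ∃ a ∈ A, (z.2 - a.2) (z.1 - a.1) ≤ 0 := by
  by_contra! h
  simpa using h z (hA.mem_of_apply_sub_nonneg fun a ha => (h a ha).le)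

lemma sq_norm_sub_le_rQ (z p : E × (E →L[ℝ] ℝ)) :
    ‖z - p‖ ^ 2 / 2 + (z.2 - p.2) (z.1 - p.1) ≤ rQ z p := by
  have h : ‖z - p‖ ^ 2 ≤ ‖z.1 - p.1‖ ^ 2 + ‖z.2 - p.2‖ ^ 2 := by
    rw [Prod.norm_def]
    rcases max_choice ‖(z - p).1‖ ‖(z - p).2‖ with h | h <;> rw [h]
    · simp
    · simp
  simp only [rQ]
  linarith

lemma rQ_nonneg (z p : E × (E →L[ℝ] ℝ)) : 0 ≤ rQ z p := by
  have h := neg_le_of_abs_le ((z.2 - p.2).le_opNorm (z.1 - p.1))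
  simp only [rQ]
  nlinarith [sq_nonneg (‖z.1 - p.1‖ - ‖z.2 - p.2‖)]

lemma abs_apply_le_norm_mul_norm (u v : E × (E →L[ℝ] ℝ)) : |u.2 v.1| ≤ ‖u‖ * ‖v‖ :=
  (u.2.le_opNorm v.1).trans
    (mul_le_mul (norm_snd_le u) (norm_fst_le v) (norm_nonneg _) (norm_nonneg _))

/-- Points at which the Fitzpatrick function of a maximally monotone set almost agrees with the
duality pairing cannot be too negatively related. -/
lemma MaxMonotone.le_apply_sub {A : Set (E × (E →L[ℝ] ℝ))} (hA : MaxMonotone A)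
    {z p : E × (E →L[ℝ] ℝ)} {δ ε : ℝ} (hz : ∀ a ∈ A, -ε ≤ (z.2 - a.2) (z.1 - a.1))
    (hp : ∀ a ∈ A, -δ ≤ (p.2 - a.2) (p.1 - a.1)) :
    -(2 * (ε + δ)) ≤ (z.2 - p.2) (z.1 - p.1) := by
  obtain ⟨a, ha, h⟩ := hA.exists_apply_sub_nonpos ((1 / 2 : ℝ) • (z + p))
  have h1 := hz a ha
  have h2 := hp a ha
  simp only [Prod.fst_add, Prod.snd_add, Prod.smul_fst, Prod.smul_snd, map_add, map_sub, map_smul,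
    smul_eq_mul, add_apply, sub_apply,
    smul_apply] at *
  linarith

lemma MaxMonotone.exists_rQ_le {A : Set (E × (E →L[ℝ] ℝ))} (hA : MaxMonotone A)
    (hsurj : ∀ x' : E →L[ℝ] ℝ, ∃ x : E, (x, x') ∈ A) (p : E × (E →L[ℝ] ℝ)) {ε : ℝ}
    (hε : 0 < ε) :
    ∃ z : E × (E →L[ℝ] ℝ), rQ z p ≤ ε ∧ ∀ a ∈ A, -ε ≤ (z.2 - a.2) (z.1 - a.1) := by
  obtain ⟨z, hz⟩ := exists_fitzpatrick_add_half_sq_norm_le hA.1 hsurj p hε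
  refine ⟨z, ?_, fun a ha => ?_⟩
  · obtain ⟨a, ha, h⟩ := hA.exists_apply_sub_nonpos z
    linarith [hz a ha]
  · linarith [hz a ha, rQ_nonneg z p]

/-- A Brøndsted–Rockafellar property of surjective maximally monotone sets. -/
lemma MaxMonotone.exists_mem_dist_le [CompleteSpace E] {A : Set (E × (E →L[ℝ] ℝ))}
    (hA : MaxMonotone A) (hsurj : ∀ x' : E →L[ℝ] ℝ, ∃ x : E, (x, x') ∈ A)
    {z : E × (E →L[ℝ] ℝ)} {η : ℝ} (hη : 0 < η)
    (hz : ∀ a ∈ A, -η ^ 2 ≤ (z.2 - a.2) (z.1 - a.1)) : ∃ a ∈ A, dist z a ≤ 6 * η := by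
  have hδ : ∀ n : ℕ, 0 < (η / 2 ^ n) ^ 2 := fun n => by positivity
  choose next hnext1 hnext2 using fun (n : ℕ) (p : E × (E →L[ℝ] ℝ)) =>
    hA.exists_rQ_le hsurj p (hδ (n + 1))
  let w : ℕ → E × (E →L[ℝ] ℝ) := fun n => Nat.rec z next n
  have hw : ∀ n, ∀ a ∈ A, -(η / 2 ^ n) ^ 2 ≤ ((w n).2 - a.2) ((w n).1 - a.1) := by
    rintro (_ | n)
    · simpa [w] using hz
    · exact hnext2 n (w n)
  have hdist : ∀ n, dist (w n) (w (n + 1)) ≤ 6 * η / 2 / 2 ^ n := by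
    intro n
    have h1 : rQ (w (n + 1)) (w n) ≤ (η / 2 ^ (n + 1)) ^ 2 := hnext1 n (w n)
    have h2 := hA.le_apply_sub (hw (n + 1)) (hw n)
    have h3 := sq_norm_sub_le_rQ (w (n + 1)) (w n)
    have h4 : η / 2 ^ (n + 1) = (η / 2 ^ n) / 2 := by rw [pow_succ]; field_simp
    rw [h4] at h1 h2
    rw [dist_comm, dist_eq_norm, show 6 * η / 2 / 2 ^ n = 3 * (η / 2 ^ n) by ring]
    refine abs_le_of_sq_le_sq' ?_ (by positivity) |>.2
    nlinarith [hδ n]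
  obtain ⟨a, ha⟩ := cauchySeq_tendsto_of_complete (cauchySeq_of_le_geometric_two hdist)
  refine ⟨a, hA.mem_of_apply_sub_nonneg fun b hb => ?_,
    dist_le_of_le_geometric_two_of_tendsto₀ hdist ha⟩
  have hlim : Tendsto (fun n => ((w n).2 - b.2) ((w n).1 - b.1)) atTop
      (𝓝 ((a.2 - b.2) (a.1 - b.1))) := by
    have hcont : Continuous fun y : E × (E →L[ℝ] ℝ) => (y.2 - b.2) (y.1 - b.1) := by fun_prop
    exact (hcont.tendsto a).comp ha
  have hlim0 : Tendsto (fun n : ℕ => -(η / 2 ^ n) ^ 2) atTop (𝓝 0) := by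
    have h := tendsto_const_nhds (x := η).div_atTop
      (tendsto_pow_atTop_atTop_of_one_lt (one_lt_two (α := ℝ)))
    simpa using (h.pow 2).neg
  exact le_of_tendsto_of_tendsto' hlim0 hlim fun n => hw n b hb

lemma norm_sub_le_of_rQ_le {z p a : E × (E →L[ℝ] ℝ)} (h : rQ z p ≤ 1)
    (ha : -1 ≤ (z.2 - a.2) (z.1 - a.1)) : ‖z - p‖ ≤ 2 + 5 * ‖a - p‖ := by
  have h0 := sq_norm_sub_le_rQ z p
  have h1 := neg_le_of_abs_le (abs_apply_le_norm_mul_norm (z - p) (a - p))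
  have h2 := neg_le_of_abs_le (abs_apply_le_norm_mul_norm (a - p) (z - p))
  have h3 := le_of_abs_le (abs_apply_le_norm_mul_norm (a - p) (a - p))
  have h4 : (z.2 - a.2) (z.1 - a.1) = (z.2 - p.2) (z.1 - p.1) - (z - p).2 (a - p).1
      - (a - p).2 (z - p).1 + (a - p).2 (a - p).1 := by
    simp only [Prod.fst_sub, Prod.snd_sub, map_sub, sub_apply]
    ring
  by_contra! hlt
  nlinarith [norm_nonneg (a - p), norm_nonneg (z - p)]

lemma rQ_le_rQ_add (a z p : E × (E →L[ℝ] ℝ)) :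
    rQ a p ≤ rQ z p + 4 * ‖z - p‖ * ‖a - z‖ + 2 * ‖a - z‖ ^ 2 := by
  have h1 := le_of_abs_le (abs_apply_le_norm_mul_norm (z - p) (a - z))
  have h2 := le_of_abs_le (abs_apply_le_norm_mul_norm (a - z) (z - p))
  have h3 := le_of_abs_le (abs_apply_le_norm_mul_norm (a - z) (a - z))
  have h4 : (a.2 - p.2) (a.1 - p.1) = (z.2 - p.2) (z.1 - p.1) + (z - p).2 (a - z).1
      + (a - z).2 (z - p).1 + (a - z).2 (a - z).1 := by
    simp only [Prod.fst_sub, Prod.snd_sub, map_sub, sub_apply]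
    ring
  have h5 : ‖a.1 - p.1‖ ≤ ‖z.1 - p.1‖ + ‖a - z‖ := by
    linarith [norm_sub_le_norm_sub_add_norm_sub a.1 z.1 p.1, norm_fst_le (a - z),
      congrArg norm (Prod.fst_sub a z)]
  have h6 : ‖a.2 - p.2‖ ≤ ‖z.2 - p.2‖ + ‖a - z‖ := by
    linarith [norm_sub_le_norm_sub_add_norm_sub a.2 z.2 p.2, norm_snd_le (a - z),
      congrArg norm (Prod.snd_sub a z)]
  have h7 := pow_le_pow_left₀ (norm_nonneg _) h5 2
  have h8 := pow_le_pow_left₀ (norm_nonneg _) h6 2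
  have h9 := mul_le_mul_of_nonneg_right (norm_fst_le (z - p)) (norm_nonneg (a - z))
  have h10 := mul_le_mul_of_nonneg_right (norm_snd_le (z - p)) (norm_nonneg (a - z))
  simp only [Prod.fst_sub, Prod.snd_sub] at h9 h10
  simp only [rQ]
  linarith

theorem statement12 [CompleteSpace E] [Nontrivial E]
    (A : Set (E × (E →L[ℝ] ℝ))) (hA : MaxMonotone A)
    (hsurj : ∀ x' : E →L[ℝ] ℝ, ∃ x : E, (x, x') ∈ A) :
    StablyQuasidense A := by
  intro p
  obtain ⟨b, hb⟩ := hA.1.1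
  let M := 2 + 5 * ‖b - p‖
  have hM : 0 ≤ M := by positivity
  refine ⟨2 * (M + 6), by positivity, ?_⟩
  by_contra! hlt
  obtain ⟨ε, hε, hε'⟩ := EReal.lt_iff_exists_real_btwn.1 hlt
  have hε : 0 < ε := by exact_mod_cast hε
  obtain ⟨η, hη, hη1, hηε⟩ : ∃ η : ℝ, 0 < η ∧ η ≤ 1 ∧ η * (24 * M + 73) ≤ ε := by
    have hpos : 0 < 24 * M + 73 := by positivity
    exact ⟨min 1 (ε / (24 * M + 73)), by positivity, min_le_left _ _,
      (le_div_iff₀ hpos).1 (min_le_right _ _)⟩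
  have hη2 : η ^ 2 ≤ 1 := pow_le_one₀ hη.le hη1
  obtain ⟨z, hzp, hz⟩ := hA.exists_rQ_le hsurj p (pow_pos hη 2)
  have hzM : ‖z - p‖ ≤ M := norm_sub_le_of_rQ_le (hzp.trans hη2) (by linarith [hz b hb])
  obtain ⟨a, ha, hd⟩ := hA.exists_mem_dist_le hsurj hη hz
  rw [dist_comm, dist_eq_norm] at hd
  have hap : ‖a - p‖ ≤ M + 6 := by linarith [norm_sub_le_norm_sub_add_norm_sub a z p]
  have hr : rQ a p ≤ ε := by
    have h1 := rQ_le_rQ_add a z p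
    have h2 : ‖z - p‖ * ‖a - z‖ ≤ M * (6 * η) := mul_le_mul hzM hd (norm_nonneg _) hM
    have h3 : ‖a - z‖ ^ 2 ≤ (6 * η) ^ 2 := pow_le_pow_left₀ (norm_nonneg _) hd 2
    nlinarith
  refine hε'.not_ge ((iInf₂_le a ⟨ha, ?_⟩).trans (EReal.coe_le_coe_iff.2 hr))
  rw [Real.sqrt_le_left (by positivity)]
  have h1 := pow_le_pow_left₀ (norm_nonneg _) ((norm_fst_le (a - p)).trans hap) 2
  have h2 := pow_le_pow_left₀ (norm_nonneg _) ((norm_snd_le (a - p)).trans hap) 2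
  simp only [Prod.fst_sub, Prod.snd_sub] at h1 h2
  nlinarith
end
end
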